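/- arXiv:1901.02319 — 2 statements merged into one kernel-verified Lean document; each statement's English description precedes it below -/
import Mathlib

section
/- Assume (Hf) and (HΦ) hold, and pick a sufficiently large constant K > 0. Then for any ṽ ∈ H¹(ℝ;(ℝ^d)^5) with ‖ṽ‖_{H¹} ≤ 1 and any ϑ ∈ ℝ one has ‖N_{f;ϑ}(ṽ)‖_{L²} ≤ K ‖ṽ‖_{H¹} ‖ṽ‖_{L²}. In addition, for any pair (ϑ^A, ϑ^B) ∈ ℝ² and any pair (ṽ^A, ṽ^B) ∈ H¹(ℝ;(ℝ^d)^5) × H¹(ℝ;(ℝ^d)^5) with ‖ṽ^A‖_{H¹} ≤ 1 and ‖ṽ^B‖_{H¹} ≤ 1, one has the Lipschitz estimate ‖N_{f;ϑ^A}(ṽ^A) − N_{f;ϑ^B}(ṽ^B)‖_{L²} ≤ K [‖ṽ^A‖_{H¹} + ‖ṽ^B‖_{H¹} + |ϑ^A − ϑ^B|] [‖ṽ^A − ṽ^B‖_{L²} + |ϑ^A − ϑ^B|]. -/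
noncomputable section
open MeasureTheory Filter Finset Metric
open scoped Classical

namespace TravellingCorners

/-! ### Basic spaces and norms -/

abbrev Vec (d : ℕ) := Fin d → ℝ
abbrev VecC (d : ℕ) := Fin d → ℂ
abbrev Fn (d : ℕ) := ℝ → Vec d
abbrev FnC (d : ℕ) := ℝ → VecC d

def mapC {d : ℕ} (v : Vec d) : VecC d := fun i => (v i : ℂ)

def dotR {d : ℕ} (a b : Vec d) : ℝ := ∑ i, a i * b i
def dotC {d : ℕ} (a b : VecC d) : ℂ := ∑ i, a i * b i

def L2inner {d : ℕ} (ψ v : Fn d) : ℝ := ∫ ξ, dotR (ψ ξ) (v ξ)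
def L2innerC {d : ℕ} (ψ : Fn d) (v : FnC d) : ℂ := ∫ ξ, dotC (mapC (ψ ξ)) (v ξ)

def L2norm {d : ℕ} (g : Fn d) : ℝ := Real.sqrt (∫ ξ, ‖g ξ‖ ^ 2)
def H1norm {d : ℕ} (g : Fn d) : ℝ := L2norm g + L2norm (deriv g)
def L2normC {d : ℕ} (g : FnC d) : ℝ := Real.sqrt (∫ ξ, ‖g ξ‖ ^ 2)
def H1normC {d : ℕ} (g : FnC d) : ℝ := L2normC g + L2normC (deriv g)

def MemL2 {d : ℕ} (g : Fn d) : Prop := Integrable (fun ξ => ‖g ξ‖ ^ 2)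
def MemH1 {d : ℕ} (g : Fn d) : Prop := Differentiable ℝ g ∧ MemL2 g ∧ MemL2 (deriv g)
def MemL2C {d : ℕ} (g : FnC d) : Prop := Integrable (fun ξ => ‖g ξ‖ ^ 2)
def MemH1C {d : ℕ} (g : FnC d) : Prop := Differentiable ℝ g ∧ MemL2C g ∧ MemL2C (deriv g)

def Bdd {d : ℕ} (g : Fn d) : Prop := ∃ C, ∀ ξ, ‖g ξ‖ ≤ C
def BddC {d : ℕ} (g : FnC d) : Prop := ∃ C, ∀ ξ, ‖g ξ‖ ≤ C
def MemW1inf {d : ℕ} (g : Fn d) : Prop := Differentiable ℝ g ∧ Bdd g ∧ Bdd (deriv g)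
def MemW1infC {d : ℕ} (g : FnC d) : Prop := Differentiable ℝ g ∧ BddC g ∧ BddC (deriv g)

/-- norms for `(ℝ^d)^5`-valued functions -/
def L2norm5 {d : ℕ} (g : ℝ → Fin 5 → Vec d) : ℝ := Real.sqrt (∫ ξ, ‖g ξ‖ ^ 2)
def H1norm5 {d : ℕ} (g : ℝ → Fin 5 → Vec d) : ℝ := L2norm5 g + L2norm5 (deriv g)
def MemL25 {d : ℕ} (g : ℝ → Fin 5 → Vec d) : Prop := Integrable (fun ξ => ‖g ξ‖ ^ 2)
def MemH15 {d : ℕ} (g : ℝ → Fin 5 → Vec d) : Prop :=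
  Differentiable ℝ g ∧ MemL25 g ∧ MemL25 (deriv g)

/-- left translation `[T_ϑ p](ξ) = p(ξ+ϑ)` -/
def Tshift {d : ℕ} (ϑ : ℝ) (p : Fn d) : Fn d := fun ξ => p (ξ + ϑ)

/-- the stencil operator `τ` -/
def tau {d : ℕ} (σA σB : ℤ) (p : Fn d) (ξ : ℝ) : Fin 5 → Vec d :=
  ![p (ξ + (σA : ℝ)), p (ξ + (σB : ℝ)), p (ξ - (σA : ℝ)), p (ξ - (σB : ℝ)), p ξ]

/-! ### The standing hypotheses (Hf) and (HΦ) -/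

structure Setting (d : ℕ) where
  r : ℕ
  f : (Fin 5 → Vec d) → Vec d
  σA : ℤ
  σB : ℤ
  up : Vec d
  um : Vec d
  cstar : ℝ
  Φ : Fn d
  ψ : Fn d
  hr : 2 ≤ r
  hf : ContDiff ℝ (r : ℕ∞) f
  hfp : f (fun _ => up) = 0
  hfm : f (fun _ => um) = 0
  hgcd : Int.gcd σA σB = 1
  hcne : cstar ≠ 0
  hΦs : ContDiff ℝ ((r : ℕ∞) + 1) Φ
  hΦp : Tendsto Φ atTop (nhds up)
  hΦm : Tendsto Φ atBot (nhds um)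
  hMFDE : ∀ ξ, cstar • deriv Φ ξ = f (tau σA σB Φ ξ)

variable {d : ℕ}

def tauPt (S : Setting d) (ξ : ℝ) : Fin 5 → Vec d := tau S.σA S.σB S.Φ ξ

/-- the partial derivative `D_j f` -/
def Dj (S : Setting d) (j : Fin 5) (a : Fin 5 → Vec d) (v : Vec d) : Vec d :=
  fderiv ℝ S.f a (Pi.single j v)

/-- complex-linear extension of `D_j f` -/
def DjC (S : Setting d) (j : Fin 5) (a : Fin 5 → Vec d) (v : VecC d) : VecC d :=
  fun i => ∑ k, (Dj S j a (Pi.single k 1) i : ℂ) * v k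

/-- transpose of `D_j f` -/
def DjT (S : Setting d) (j : Fin 5) (a : Fin 5 → Vec d) (v : Vec d) : Vec d :=
  fun i => ∑ k, Dj S j a (Pi.single i 1) k * v k

/-- the linearization `L_z` -/
def Lz (S : Setting d) (z : ℂ) (p : FnC d) (ξ : ℝ) : VecC d :=
  (-(S.cstar : ℂ)) • deriv p ξ
  + Complex.exp (-(S.σB : ℂ) * z) • DjC S 0 (tauPt S ξ) (p (ξ + (S.σA : ℝ)))
  + Complex.exp ((S.σA : ℂ) * z) • DjC S 1 (tauPt S ξ) (p (ξ + (S.σB : ℝ)))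
  + Complex.exp ((S.σB : ℂ) * z) • DjC S 2 (tauPt S ξ) (p (ξ - (S.σA : ℝ)))
  + Complex.exp (-(S.σA : ℂ) * z) • DjC S 3 (tauPt S ξ) (p (ξ - (S.σB : ℝ)))
  + DjC S 4 (tauPt S ξ) (p ξ)

/-- `k`-th derivative in `z` of `L_z` at `z = 0` (valid for `k ≥ 1`) -/
def Ak (S : Setting d) (k : ℕ) (p : FnC d) (ξ : ℝ) : VecC d :=
  ((-(S.σB : ℂ)) ^ k) • DjC S 0 (tauPt S ξ) (p (ξ + (S.σA : ℝ)))
  + (((S.σA : ℂ)) ^ k) • DjC S 1 (tauPt S ξ) (p (ξ + (S.σB : ℝ)))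
  + (((S.σB : ℂ)) ^ k) • DjC S 2 (tauPt S ξ) (p (ξ - (S.σA : ℝ)))
  + ((-(S.σA : ℂ)) ^ k) • DjC S 3 (tauPt S ξ) (p (ξ - (S.σB : ℝ)))

/-- real version of `A_k` -/
def AkR (S : Setting d) (k : ℕ) (p : Fn d) (ξ : ℝ) : Vec d :=
  ((-(S.σB : ℝ)) ^ k) • Dj S 0 (tauPt S ξ) (p (ξ + (S.σA : ℝ)))
  + (((S.σA : ℝ)) ^ k) • Dj S 1 (tauPt S ξ) (p (ξ + (S.σB : ℝ)))
  + (((S.σB : ℝ)) ^ k) • Dj S 2 (tauPt S ξ) (p (ξ - (S.σA : ℝ)))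
  + ((-(S.σA : ℝ)) ^ k) • Dj S 3 (tauPt S ξ) (p (ξ - (S.σB : ℝ)))

/-- matrix of `D_j f` at a limiting state, complexified -/
def DmatC (S : Setting d) (j : Fin 5) (a : Fin 5 → Vec d) : Matrix (Fin d) (Fin d) ℂ :=
  fun i k => (Dj S j a (Pi.single k 1) i : ℂ)

/-- the limiting characteristic function `Δ^{u}_z(s)` -/
def charM (S : Setting d) (u : Vec d) (z s : ℂ) : Matrix (Fin d) (Fin d) ℂ :=
  (-(S.cstar : ℂ) * s) • (1 : Matrix (Fin d) (Fin d) ℂ)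
  + (Complex.exp (-(S.σB : ℂ) * z) * Complex.exp (s * (S.σA : ℂ))) • DmatC S 0 (fun _ => u)
  + (Complex.exp ((S.σA : ℂ) * z) * Complex.exp (s * (S.σB : ℂ))) • DmatC S 1 (fun _ => u)
  + (Complex.exp ((S.σB : ℂ) * z) * Complex.exp (-(s * (S.σA : ℂ)))) • DmatC S 2 (fun _ => u)
  + (Complex.exp (-(S.σA : ℂ) * z) * Complex.exp (-(s * (S.σB : ℂ)))) • DmatC S 3 (fun _ => u)
  + DmatC S 4 (fun _ => u)

/-- hypothesis (HS1) -/
def HS1 (S : Setting d) : Prop :=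
  ∀ ω ∈ Set.Icc (-Real.pi) Real.pi, ∀ ν : ℝ,
    (charM S S.up (Complex.I * ω) (Complex.I * ν)).det ≠ 0 ∧
    (charM S S.um (Complex.I * ω) (Complex.I * ν)).det ≠ 0

/-- hypothesis (HS2) -/
def HS2 (S : Setting d) : Prop :=
  ∀ ω : ℝ, ω ≠ 0 → ∀ h : FnC d, BddC h →
    ∃! p : FnC d, MemW1infC p ∧ ∀ ξ, Lz S (Complex.I * ω) p ξ = h ξ

/-- complexification of `Φ_*'` -/
def PhiC' (S : Setting d) : FnC d := fun ξ => mapC (deriv S.Φ ξ)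

/-- hypothesis (HS3) -/
def HS3 (S : Setting d) : Prop :=
  (∀ p : FnC d, MemW1infC p → (∀ ξ, Lz S 0 p ξ = 0) →
      ∃ a : ℂ, ∀ ξ, p ξ = a • PhiC' S ξ)
  ∧ ¬ (∃ p : FnC d, MemW1infC p ∧ ∀ ξ, Lz S 0 p ξ = PhiC' S ξ)

/-- the formal adjoint `L_0^adj` -/
def Ladj (S : Setting d) (q : Fn d) (ξ : ℝ) : Vec d :=
  S.cstar • deriv q ξ
  + DjT S 0 (tauPt S (ξ - (S.σA : ℝ))) (q (ξ - (S.σA : ℝ)))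
  + DjT S 1 (tauPt S (ξ - (S.σB : ℝ))) (q (ξ - (S.σB : ℝ)))
  + DjT S 2 (tauPt S (ξ + (S.σA : ℝ))) (q (ξ + (S.σA : ℝ)))
  + DjT S 3 (tauPt S (ξ + (S.σB : ℝ))) (q (ξ + (S.σB : ℝ)))
  + DjT S 4 (tauPt S ξ) (q ξ)

/-- the normalized adjoint kernel element `ψ_*` -/
def Hpsi (S : Setting d) : Prop :=
  MemW1inf S.ψ ∧ (∀ ξ, Ladj S S.ψ ξ = 0) ∧ L2inner S.ψ (deriv S.Φ) = 1

/-! ### The eigenvalue branch and (HM) -/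

structure EigenBranch (S : Setting d) where
  δ : ℝ
  lam : ℂ → ℂ
  phi : ℂ → FnC d
  hδ : 0 < δ
  hlam0 : lam 0 = 0
  hphi0 : phi 0 = PhiC' S
  hlam_an : ∀ z ∈ ball (0 : ℂ) δ, AnalyticAt ℂ lam z
  hphi_an : ∀ ξ : ℝ, ∀ z ∈ ball (0 : ℂ) δ, AnalyticAt ℂ (fun w => phi w ξ) z
  hmem : ∀ z ∈ ball (0 : ℂ) δ, MemW1infC (phi z)
  hker : ∀ z ∈ ball (0 : ℂ) δ, ∀ ξ, Lz S z (phi z) ξ = lam z • phi z ξ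
  hsimple : ∀ z ∈ ball (0 : ℂ) δ,
      (∀ p : FnC d, MemW1infC p → (∀ ξ, Lz S z p ξ = lam z • p ξ) →
          ∃ a : ℂ, ∀ ξ, p ξ = a • phi z ξ)
      ∧ ¬ (∃ p : FnC d, MemW1infC p ∧ ∀ ξ, Lz S z p ξ - lam z • p ξ = phi z ξ)
  hnorm : ∀ z ∈ ball (0 : ℂ) δ, L2innerC S.ψ (phi z) = 1

def lamD {S : Setting d} (E : EigenBranch S) (k : ℕ) : ℂ := iteratedDeriv k E.lam 0

def phiD {S : Setting d} (E : EigenBranch S) (k : ℕ) : FnC d :=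
  fun ξ => iteratedDeriv k (fun z => E.phi z ξ) 0

/-- hypothesis (HM): vanishing group velocity together with nondegenerate curvature -/
def HM (S : Setting d) (E : EigenBranch S) : Prop :=
  deriv E.lam 0 = 0 ∧ iteratedDeriv 2 E.lam 0 ≠ 0

/-! ### The branch of waves travelling in nearby directions -/

/-- `τ_φ`, using `σ_* cos(φ+ζ_*) = σ_A cos φ - σ_B sin φ` and
`σ_* sin(φ+ζ_*) = σ_B cos φ + σ_A sin φ` -/
def tauPhi (S : Setting d) (φ : ℝ) (p : Fn d) (ξ : ℝ) : Fin 5 → Vec d :=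
  ![p (ξ + ((S.σA : ℝ) * Real.cos φ - (S.σB : ℝ) * Real.sin φ)),
    p (ξ + ((S.σB : ℝ) * Real.cos φ + (S.σA : ℝ) * Real.sin φ)),
    p (ξ - ((S.σA : ℝ) * Real.cos φ - (S.σB : ℝ) * Real.sin φ)),
    p (ξ - ((S.σB : ℝ) * Real.cos φ + (S.σA : ℝ) * Real.sin φ)),
    p ξ]

structure WaveBranch (S : Setting d) where
  δφ : ℝ
  c : ℝ → ℝ
  Φb : ℝ → Fn d
  hδφ : 0 < δφ
  hc0 : c 0 = S.cstar
  hΦ0 : Φb 0 = S.Φ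
  hmem : ∀ φ ∈ Set.Ioo (-δφ) δφ, MemW1inf (Φb φ)
  hsmooth_c : ContDiffOn ℝ ((S.r - 1 : ℕ) : ℕ∞) c (Set.Ioo (-δφ) δφ)
  hsmooth_Φ : ∀ ξ : ℝ, ContDiffOn ℝ ((S.r - 1 : ℕ) : ℕ∞)
      (fun φ => Φb φ ξ) (Set.Ioo (-δφ) δφ)
  hmfde : ∀ φ ∈ Set.Ioo (-δφ) δφ, ∀ ξ, c φ • deriv (Φb φ) ξ = S.f (tauPhi S φ (Φb φ) ξ)
  hnorm : ∀ φ ∈ Set.Ioo (-δφ) δφ, L2inner S.ψ (Φb φ) = L2inner S.ψ S.Φ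

/-- the directional dispersion `d_φ = c_φ / cos φ` -/
def dirDisp {S : Setting d} (W : WaveBranch S) (φ : ℝ) : ℝ := W.c φ / Real.cos φ

def PhibD {S : Setting d} (W : WaveBranch S) (k : ℕ) : Fn d :=
  fun ξ => iteratedDeriv k (fun φ => W.Φb φ ξ) 0

def PhibD' {S : Setting d} (W : WaveBranch S) (k : ℕ) : Fn d :=
  fun ξ => iteratedDeriv k (fun φ => deriv (W.Φb φ) ξ) 0

def cD {S : Setting d} (W : WaveBranch S) (k : ℕ) : ℝ := iteratedDeriv k W.c 0

/-! ### Sequence spaces and operators -/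

def taubar {d : ℕ} (σA σB : ℤ) (P : Fin 5 → Fn d) (ξ : ℝ) : Fin 5 → Vec d :=
  ![P 0 (ξ + (σA : ℝ)), P 1 (ξ + (σB : ℝ)), P 2 (ξ - (σA : ℝ)), P 3 (ξ - (σB : ℝ)), P 4 ξ]

def sdia {d : ℕ} (σA σB : ℤ) (w : ℤ → Fn d) (l : ℤ) : Fin 5 → Fn d :=
  ![fun ξ => -(∑ j ∈ Finset.range σB.toNat, w (l - (j : ℤ)) ξ),
    fun ξ => ∑ j ∈ Finset.Icc 1 σA.toNat, w (l + (j : ℤ)) ξ,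
    fun ξ => ∑ j ∈ Finset.Icc 1 σB.toNat, w (l + (j : ℤ)) ξ,
    fun ξ => -(∑ j ∈ Finset.range σA.toNat, w (l - (j : ℤ)) ξ),
    fun _ => 0]

def Qh (S : Setting d) (ϑ : ℝ) (v : Fn d) : ℝ := L2inner (Tshift ϑ S.ψ) v
def Ph (S : Setting d) (ϑ : ℝ) (v : Fn d) : Fn d := fun ξ => Qh S ϑ v • deriv S.Φ (ξ + ϑ)

/-- the operator `L_*^{(ϑ)}` -/
def Lop (S : Setting d) (ϑ : ℝ) (v : Fn d) : Fn d :=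
  fun ξ => (-S.cstar) • deriv v ξ
    + fderiv ℝ S.f (tau S.σA S.σB (Tshift ϑ S.Φ) ξ) (tau S.σA S.σB v ξ)

/-- the nonlinearity `N_{f;ϑ}` -/
def Nf (S : Setting d) (ϑ : ℝ) (vt : ℝ → Fin 5 → Vec d) : Fn d :=
  fun ξ => S.f (tau S.σA S.σB (Tshift ϑ S.Φ) ξ + vt ξ)
         - S.f (tau S.σA S.σB (Tshift ϑ S.Φ) ξ)
         - fderiv ℝ S.f (tau S.σA S.σB (Tshift ϑ S.Φ) ξ) (vt ξ)

/-- the nonlinearity `N_{Φ_*;ϑ}` -/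
def NPhi (S : Setting d) (ϑ θd : ℝ) : Fn d :=
  fun ξ => S.Φ (ξ + ϑ + θd) - S.Φ (ξ + ϑ) - θd • deriv S.Φ (ξ + ϑ)

def Tseq (S : Setting d) (θ : ℤ → ℝ) (v w : ℤ → Fn d) (l : ℤ) : Fn d × Fn d :=
  (w (l + 1), fun ξ => -(Lop S (θ l) (v l) ξ))

def Dseq (S : Setting d) (θ : ℤ → ℝ) (v w : ℤ → Fn d) (l : ℤ) : Fn d × Fn d :=
  (fun ξ => v (l + 1) ξ - v l ξ,
   fun ξ => fderiv ℝ S.f (tau S.σA S.σB (Tshift (θ l) S.Φ) ξ)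
              (taubar S.σA S.σB (sdia S.σA S.σB w l) ξ))

/-- the scalar nonlinearity `S(ev_l(θ,v,w))` -/
def Sfun (S : Setting d) (θ : ℤ → ℝ) (v : ℤ → Fn d) (l : ℤ) : ℝ :=
  (Qh S (θ (l + 1)) (v (l + 1)) - Qh S (θ l) (v (l + 1)))
  - Qh S (θ l) (NPhi S (θ l) (θ (l + 1) - θ l))

/-- the nonlinearity `R(ev_l(θ,v,w))` -/
def Rfun (S : Setting d) (c : ℝ) (θ : ℤ → ℝ) (v w : ℤ → Fn d) (l : ℤ) : Fn d × Fn d :=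
  (fun ξ => -(Sfun S θ v l) • deriv S.Φ (ξ + θ l) - NPhi S (θ l) (θ (l + 1) - θ l) ξ,
   fun ξ => (c - S.cstar) • deriv (v l) ξ
     - Nf S (θ l)
        (fun ζ => tau S.σA S.σB (v l) ζ + taubar S.σA S.σB (sdia S.σA S.σB w l) ζ) ξ)

/-- the reduced system (★) -/
def ReducedSystem (S : Setting d) (c : ℝ) (θ : ℤ → ℝ) (v w : ℤ → Fn d) : Prop :=
  ∀ l : ℤ,
    (θ (l + 1) - θ l = Qh S (θ l) (w (l + 1)) + Sfun S θ v l) ∧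
    ((Dseq S θ v w l).1 = fun ξ =>
        (Tseq S θ v w l).1 ξ - Ph S (θ l) ((Tseq S θ v w l).1) ξ
        + (Rfun S c θ v w l).1 ξ) ∧
    ((Dseq S θ v w l).2 = fun ξ =>
        (Tseq S θ v w l).2 ξ + (c - S.cstar) • deriv S.Φ (ξ + θ l)
        + (Rfun S c θ v w l).2 ξ)

/-- `σ̂ = max(|σ_A|, |σ_B|)` -/
def shat (S : Setting d) : ℕ := max S.σA.natAbs S.σB.natAbs

def window (S : Setting d) (l : ℤ) : Finset ℤ :=
  Finset.Icc (l - (shat S : ℤ) + 1) (l + (shat S : ℤ))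

def evH1 (S : Setting d) (v : ℤ → Fn d) (l : ℤ) : ℝ := ∑ j ∈ window S l, H1norm (v j)
def evL2 (S : Setting d) (v : ℤ → Fn d) (l : ℤ) : ℝ := ∑ j ∈ window S l, L2norm (v j)
def evAbs (S : Setting d) (θ : ℤ → ℝ) (l : ℤ) : ℝ := ∑ j ∈ window S l, |θ j|

/-! ### Exponentially weighted sequence spaces (real pairs) -/

def pairHH {d : ℕ} (P : Fn d × Fn d) : ℝ := H1norm P.1 + H1norm P.2
def pairHL {d : ℕ} (P : Fn d × Fn d) : ℝ := H1norm P.1 + L2norm P.2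

def MemBSHH (η : ℝ) (V : ℤ → Fn d × Fn d) : Prop :=
  (∀ l, MemH1 (V l).1 ∧ MemH1 (V l).2) ∧
  ∃ C, ∀ l : ℤ, pairHH (V l) ≤ C * Real.exp (η * |(l : ℝ)|)

def MemBSHL (η : ℝ) (V : ℤ → Fn d × Fn d) : Prop :=
  (∀ l, MemH1 (V l).1 ∧ MemL2 (V l).2) ∧
  ∃ C, ∀ l : ℤ, pairHL (V l) ≤ C * Real.exp (η * |(l : ℝ)|)

/-- the constant-coefficient system (CC) -/
def CCsys (S : Setting d) (ϑ : ℝ) (V H : ℤ → Fn d × Fn d) : Prop :=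
  ∀ l : ℤ,
    ((Dseq S (fun _ => ϑ) (fun m => (V m).1) (fun m => (V m).2) l).1 = fun ξ =>
        (Tseq S (fun _ => ϑ) (fun m => (V m).1) (fun m => (V m).2) l).1 ξ
        - Ph S ϑ ((Tseq S (fun _ => ϑ) (fun m => (V m).1) (fun m => (V m).2) l).1) ξ
        + (H l).1 ξ) ∧
    ((Dseq S (fun _ => ϑ) (fun m => (V m).1) (fun m => (V m).2) l).2 = fun ξ =>
        (Tseq S (fun _ => ϑ) (fun m => (V m).1) (fun m => (V m).2) l).2 ξ + (H l).2 ξ)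

/-- the slowly varying operator `Λ(θ)` -/
def LambdaOp (S : Setting d) (θ : ℤ → ℝ) (V : ℤ → Fn d × Fn d) (l : ℤ) : Fn d × Fn d :=
  (fun ξ => (Dseq S θ (fun m => (V m).1) (fun m => (V m).2) l).1 ξ
      - ((Tseq S θ (fun m => (V m).1) (fun m => (V m).2) l).1 ξ
          - Ph S (θ l) ((Tseq S θ (fun m => (V m).1) (fun m => (V m).2) l).1) ξ),
   fun ξ => (Dseq S θ (fun m => (V m).1) (fun m => (V m).2) l).2 ξ
      - (Tseq S θ (fun m => (V m).1) (fun m => (V m).2) l).2 ξ)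

/-! ### Complexified sequence machinery -/

def taubarC {d : ℕ} (σA σB : ℤ) (P : Fin 5 → FnC d) (ξ : ℝ) : Fin 5 → VecC d :=
  ![P 0 (ξ + (σA : ℝ)), P 1 (ξ + (σB : ℝ)), P 2 (ξ - (σA : ℝ)), P 3 (ξ - (σB : ℝ)), P 4 ξ]

def sdiaC {d : ℕ} (σA σB : ℤ) (w : ℤ → FnC d) (l : ℤ) : Fin 5 → FnC d :=
  ![fun ξ => -(∑ j ∈ Finset.range σB.toNat, w (l - (j : ℤ)) ξ),
    fun ξ => ∑ j ∈ Finset.Icc 1 σA.toNat, w (l + (j : ℤ)) ξ,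
    fun ξ => ∑ j ∈ Finset.Icc 1 σB.toNat, w (l + (j : ℤ)) ξ,
    fun ξ => -(∑ j ∈ Finset.range σA.toNat, w (l - (j : ℤ)) ξ),
    fun _ => 0]

def TseqC (S : Setting d) (V : ℤ → FnC d × FnC d) (l : ℤ) : FnC d × FnC d :=
  ((V (l + 1)).2, fun ξ => -(Lz S 0 ((V l).1) ξ))

def DseqC (S : Setting d) (V : ℤ → FnC d × FnC d) (l : ℤ) : FnC d × FnC d :=
  (fun ξ => (V (l + 1)).1 ξ - (V l).1 ξ,
   fun ξ => ∑ j : Fin 5, DjC S j (tauPt S ξ)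
       (taubarC S.σA S.σB (sdiaC S.σA S.σB (fun m => (V m).2) l) ξ j))

def pairSubC {d : ℕ} (A B : FnC d × FnC d) : FnC d × FnC d :=
  (fun ξ => A.1 ξ - B.1 ξ, fun ξ => A.2 ξ - B.2 ξ)

def pairAddC {d : ℕ} (A B : FnC d × FnC d) : FnC d × FnC d :=
  (fun ξ => A.1 ξ + B.1 ξ, fun ξ => A.2 ξ + B.2 ξ)

/-- the symbol sequence `s^◇_z` -/
def sdz (σA σB : ℤ) (z : ℂ) : Fin 5 → ℂ :=
  ![-(∑ j ∈ Finset.range σB.toNat, Complex.exp (-z * (j : ℂ))),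
    ∑ j ∈ Finset.Icc 1 σA.toNat, Complex.exp (z * (j : ℂ)),
    ∑ j ∈ Finset.Icc 1 σB.toNat, Complex.exp (z * (j : ℂ)),
    -(∑ j ∈ Finset.range σA.toNat, Complex.exp (-z * (j : ℂ))),
    0]

def tauZ {d : ℕ} (σA σB : ℤ) (w : FnC d) (ξ : ℝ) : Fin 5 → VecC d :=
  ![w (ξ + (σA : ℝ)), w (ξ + (σB : ℝ)), w (ξ - (σA : ℝ)), w (ξ - (σB : ℝ)), w ξ]

/-- the Fourier symbol `Δ(z)` -/
def DeltaOp (S : Setting d) (z : ℂ) (V : FnC d × FnC d) : FnC d × FnC d :=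
  (fun ξ => (Complex.exp z - 1) • V.1 ξ - Complex.exp z • V.2 ξ,
   fun ξ => Lz S 0 V.1 ξ
     + ∑ j : Fin 5, sdz S.σA S.σB z j • DjC S j (tauPt S ξ) (tauZ S.σA S.σB V.2 ξ j))

/-- a choice of inverse for `Δ(z)` -/
def DeltaInv (S : Setting d) (z : ℂ) (G : FnC d × FnC d) : FnC d × FnC d :=
  if h : ∃ V : FnC d × FnC d, (MemH1C V.1 ∧ MemH1C V.2) ∧
      (∀ ξ, (DeltaOp S z V).1 ξ = G.1 ξ) ∧ (∀ ξ, (DeltaOp S z V).2 ξ = G.2 ξ)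
  then h.choose else 0

/-! ### Discrete Laplace transforms -/

def ZpF {d : ℕ} (g : ℤ → FnC d) (z : ℂ) : FnC d :=
  fun ξ => ∑' n : ℕ, Complex.exp (-z * (n : ℂ)) • g (n : ℤ) ξ

def ZmF {d : ℕ} (g : ℤ → FnC d) (z : ℂ) : FnC d :=
  fun ξ => ∑' n : ℕ, Complex.exp (z * ((n : ℂ) + 1)) • g (-(n : ℤ) - 1) ξ

def ZpPair {d : ℕ} (Hs : ℤ → FnC d × FnC d) (z : ℂ) : FnC d × FnC d :=
  (ZpF (fun l => (Hs l).1) z, ZpF (fun l => (Hs l).2) z)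

def ZmPair {d : ℕ} (Hs : ℤ → FnC d × FnC d) (z : ℂ) : FnC d × FnC d :=
  (ZmF (fun l => (Hs l).1) z, ZmF (fun l => (Hs l).2) z)

/-! ### Complex pair memberships -/

def pairHHC {d : ℕ} (P : FnC d × FnC d) : ℝ := H1normC P.1 + H1normC P.2
def pairHLC {d : ℕ} (P : FnC d × FnC d) : ℝ := H1normC P.1 + L2normC P.2

def MemBXC (μ ν : ℝ) (V : ℤ → FnC d × FnC d) : Prop :=
  (∀ l, MemH1C (V l).1 ∧ MemH1C (V l).2) ∧
  ∃ C, (∀ l : ℤ, l < 0 → pairHHC (V l) ≤ C * Real.exp (μ * (l : ℝ))) ∧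
       (∀ l : ℤ, 0 ≤ l → pairHHC (V l) ≤ C * Real.exp (ν * (l : ℝ)))

def Meml2HLC (η : ℝ) (V : ℤ → FnC d × FnC d) : Prop :=
  (∀ l, MemH1C (V l).1 ∧ MemL2C (V l).2) ∧
  Summable (fun l : ℤ => Real.exp (-2 * η * (l : ℝ)) * (pairHLC (V l)) ^ 2)

def MemlinfHLC (η : ℝ) (V : ℤ → FnC d × FnC d) : Prop :=
  (∀ l, MemH1C (V l).1 ∧ MemL2C (V l).2) ∧
  ∃ C, ∀ l : ℤ, pairHLC (V l) ≤ C * Real.exp (η * (l : ℝ))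

def MemlinfHHC (η : ℝ) (V : ℤ → FnC d × FnC d) : Prop :=
  (∀ l, MemH1C (V l).1 ∧ MemH1C (V l).2) ∧
  ∃ C, ∀ l : ℤ, pairHHC (V l) ≤ C * Real.exp (η * (l : ℝ))

/-- the explicit inverse `Λ^{inv}_η` -/
def LamInv (S : Setting d) (η : ℝ) (Hs : ℤ → FnC d × FnC d) (l : ℤ) : FnC d × FnC d :=
  (fun ξ => (1 / (2 * Real.pi)) •
      ∫ t in (-Real.pi)..Real.pi,
        Complex.exp (((η : ℂ) + Complex.I * (t : ℂ)) * (l : ℂ)) •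
          (DeltaInv S ((η : ℂ) + Complex.I * (t : ℂ))
            (pairAddC (ZpPair Hs ((η : ℂ) + Complex.I * (t : ℂ)))
                      (ZmPair Hs ((η : ℂ) + Complex.I * (t : ℂ))))).1 ξ,
   fun ξ => (1 / (2 * Real.pi)) •
      ∫ t in (-Real.pi)..Real.pi,
        Complex.exp (((η : ℂ) + Complex.I * (t : ℂ)) * (l : ℂ)) •
          (DeltaInv S ((η : ℂ) + Complex.I * (t : ℂ))
            (pairAddC (ZpPair Hs ((η : ℂ) + Complex.I * (t : ℂ)))
                      (ZmPair Hs ((η : ℂ) + Complex.I * (t : ℂ))))).2 ξ)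

/-! ### The operators `q_z` and `Q(z)` -/

def qz (S : Setting d) (z : ℂ) (w : ℤ → FnC d) : Fin 5 → FnC d :=
  ![fun ξ => ∑ j ∈ Finset.Icc 1 (S.σB.toNat - 1),
        (∑ k ∈ Finset.Icc j (S.σB.toNat - 1), Complex.exp (-z * ((k : ℂ) - (j : ℂ)))) •
          w (-(j : ℤ)) ξ,
    fun ξ => ∑ j ∈ Finset.range S.σA.toNat,
        (∑ k ∈ Finset.Icc (j + 1) S.σA.toNat, Complex.exp (z * ((k : ℂ) - (j : ℂ)))) •
          w (j : ℤ) ξ,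
    fun ξ => ∑ j ∈ Finset.range S.σB.toNat,
        (∑ k ∈ Finset.Icc (j + 1) S.σB.toNat, Complex.exp (z * ((k : ℂ) - (j : ℂ)))) •
          w (j : ℤ) ξ,
    fun ξ => ∑ j ∈ Finset.Icc 1 (S.σA.toNat - 1),
        (∑ k ∈ Finset.Icc j (S.σA.toNat - 1), Complex.exp (-z * ((k : ℂ) - (j : ℂ)))) •
          w (-(j : ℤ)) ξ,
    fun _ => 0]

def QzOp (S : Setting d) (z : ℂ) (V : ℤ → FnC d × FnC d) : FnC d × FnC d :=
  (fun ξ => Complex.exp z • ((V 0).1 ξ - (V 0).2 ξ),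
   fun ξ => ∑ j : Fin 5, DjC S j (tauPt S ξ)
       (taubarC S.σA S.σB (qz S z (fun m => (V m).2)) ξ j))

/-- the homogeneous solutions `V^A_hom` and `V^B_hom` (complexified) -/
def VAhomC (S : Setting d) : ℤ → FnC d × FnC d := fun _ => (PhiC' S, 0)

def VBhomC (S : Setting d) (E : EigenBranch S) : ℤ → FnC d × FnC d :=
  fun l => (fun ξ => (l : ℂ) • PhiC' S ξ + phiD E 1 ξ, PhiC' S)

def ev0C (S : Setting d) (V : ℤ → FnC d × FnC d) : Fin (2 * shat S) → FnC d × FnC d :=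
  fun j => V ((j : ℤ) - (shat S : ℤ) + 1)

end TravellingCorners

namespace TravellingCorners

section Pointwise

variable {E F : Type*} [NormedAddCommGroup E] [NormedSpace ℝ E]
  [NormedAddCommGroup F] [NormedSpace ℝ F]

/-- The derivative of a `C²` map is Lipschitz on every closed ball centred at the origin. -/
lemma exists_fderiv_lipschitz_closedBall [ProperSpace E] {f : E → F} (hf : ContDiff ℝ 2 f)
    (R : ℝ) :
    ∃ L, 0 ≤ L ∧ ∀ a ∈ closedBall (0 : E) R, ∀ b ∈ closedBall (0 : E) R,
      ‖fderiv ℝ f a - fderiv ℝ f b‖ ≤ L * ‖a - b‖ := by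
  have h1 : ContDiff ℝ 1 (fderiv ℝ f) := hf.fderiv_right (by norm_num)
  obtain ⟨C, hC⟩ := (isCompact_closedBall (0 : E) R).exists_bound_of_continuousOn
    (h1.continuous_fderiv one_ne_zero).continuousOn
  refine ⟨max C 0, le_max_right _ _, fun a ha b hb => ?_⟩
  exact (convex_closedBall (0 : E) R).norm_image_sub_le_of_norm_fderiv_le
    (fun x _ => (h1.differentiable one_ne_zero) x)
    (fun x hx => (hC x hx).trans (le_max_left _ _)) hb ha

variable {f : E → F} {s : Set E} {L : ℝ}

lemma norm_sub_sub_fderiv_le (hf : Differentiable ℝ f) (hs : Convex ℝ s) (hL : 0 ≤ L)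
    (hlip : ∀ a ∈ s, ∀ b ∈ s, ‖fderiv ℝ f a - fderiv ℝ f b‖ ≤ L * ‖a - b‖)
    {a v w : E} (ha : a ∈ s) (hv : a + v ∈ s) (hw : a + w ∈ s) :
    ‖f (a + v) - f (a + w) - fderiv ℝ f a (v - w)‖ ≤ L * (‖v‖ + ‖w‖) * ‖v - w‖ := by
  have key := (hs.inter (convex_closedBall a (‖v‖ + ‖w‖))).norm_image_sub_le_of_norm_fderiv_le'
    (f := f) (φ := fderiv ℝ f a) (C := L * (‖v‖ + ‖w‖)) (x := a + w) (y := a + v) (𝕜 := ℝ)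
    (fun x _ => hf x)
    (fun x hx => (hlip x hx.1 a ha).trans
      (mul_le_mul_of_nonneg_left (mem_closedBall_iff_norm.1 hx.2) hL))
    ⟨hw, by simp⟩ ⟨hv, by simp⟩
  simpa using key

lemma norm_remainder_sub_base_le (hf : Differentiable ℝ f) (hs : Convex ℝ s)
    (hlip : ∀ a ∈ s, ∀ b ∈ s, ‖fderiv ℝ f a - fderiv ℝ f b‖ ≤ L * ‖a - b‖)
    {a b w : E} (ha : a ∈ s) (hb : b ∈ s) (haw : a + w ∈ s) (hbw : b + w ∈ s) :
    ‖(f (a + w) - f a - fderiv ℝ f a w) - (f (b + w) - f b - fderiv ℝ f b w)‖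
      ≤ 2 * L * ‖w‖ * ‖a - b‖ := by
  have h1 : ‖(f (a + w) - f a) - (f (b + w) - f b)‖ ≤ L * ‖w‖ * ‖a - b‖ := by
    have hd (x : E) : HasFDerivAt (fun x => f (x + w) - f x)
        (fderiv ℝ f (x + w) - fderiv ℝ f x) x :=
      ((hasFDerivAt_comp_add_right w).2 (hf (x + w)).hasFDerivAt).sub (hf x).hasFDerivAt
    refine (hs.inter (hs.translate_preimage_left w)).norm_image_sub_le_of_norm_hasFDerivWithin_le
      (f := fun x => f (x + w) - f x) (fun x _ => (hd x).hasFDerivWithinAt) (fun x hx => ?_)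
      ⟨hb, hbw⟩ ⟨ha, haw⟩
    simpa using hlip (x + w) hx.2 x hx.1
  have h2 : ‖(fderiv ℝ f a - fderiv ℝ f b) w‖ ≤ L * ‖a - b‖ * ‖w‖ :=
    (ContinuousLinearMap.le_opNorm _ _).trans
      (mul_le_mul_of_nonneg_right (hlip a ha b hb) (norm_nonneg w))
  calc _ = ‖((f (a + w) - f a) - (f (b + w) - f b)) - (fderiv ℝ f a - fderiv ℝ f b) w‖ := by
        rw [sub_apply]; congr 1; abel
    _ ≤ L * ‖w‖ * ‖a - b‖ + L * ‖a - b‖ * ‖w‖ := (norm_sub_le _ _).trans (add_le_add h1 h2)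
    _ = _ := by ring

lemma norm_remainder_sub_le (hf : Differentiable ℝ f) (hs : Convex ℝ s) (hL : 0 ≤ L)
    (hlip : ∀ a ∈ s, ∀ b ∈ s, ‖fderiv ℝ f a - fderiv ℝ f b‖ ≤ L * ‖a - b‖)
    {a b v w : E} (ha : a ∈ s) (hb : b ∈ s) (hav : a + v ∈ s) (haw : a + w ∈ s)
    (hbw : b + w ∈ s) :
    ‖(f (a + v) - f a - fderiv ℝ f a v) - (f (b + w) - f b - fderiv ℝ f b w)‖
      ≤ L * (‖v‖ + ‖w‖) * ‖v - w‖ + 2 * L * ‖w‖ * ‖a - b‖ := by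
  calc _ = ‖(f (a + v) - f (a + w) - fderiv ℝ f a (v - w)) +
          ((f (a + w) - f a - fderiv ℝ f a w) - (f (b + w) - f b - fderiv ℝ f b w))‖ := by
        rw [map_sub]; congr 1; abel
    _ ≤ _ := (norm_add_le _ _).trans (add_le_add
        (norm_sub_sub_fderiv_le hf hs hL hlip ha hav haw)
        (norm_remainder_sub_base_le hf hs hlip ha hb haw hbw))

end Pointwise

section Sobolev

variable {E : Type*} [NormedAddCommGroup E]

lemma norm_le_one_add_norm_sq (x : E) : ‖x‖ ≤ 1 + ‖x‖ ^ 2 := by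
  nlinarith [sq_nonneg (‖x‖ - 1), norm_nonneg x]

lemma sq_intervalIntegral_le {g : ℝ → ℝ} {x : ℝ}
    (hg : IntervalIntegrable g volume x (x + 1))
    (hg2 : IntervalIntegrable (fun y => g y ^ 2) volume x (x + 1)) :
    (∫ y in x..x + 1, g y) ^ 2 ≤ ∫ y in x..x + 1, g y ^ 2 := by
  set m := ∫ y in x..x + 1, g y with hm
  have h0 : 0 ≤ ∫ y in x..x + 1, (g y ^ 2 - 2 * m * g y + m ^ 2) :=
    intervalIntegral.integral_nonneg (by linarith) fun y _ => by nlinarith [sq_nonneg (g y - m)]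
  rw [intervalIntegral.integral_add (hg2.sub (hg.const_mul _)) (by simp),
    intervalIntegral.integral_sub hg2 (hg.const_mul _),
    intervalIntegral.integral_const_mul, ← hm] at h0
  simp at h0
  nlinarith

/-- The one-dimensional Sobolev embedding of `H¹` into `L∞`. -/
lemma norm_sq_le_of_memH1 [NormedSpace ℝ E] [CompleteSpace E] {v : ℝ → E}
    (hv : Differentiable ℝ v) (h0 : Integrable fun ξ => ‖v ξ‖ ^ 2)
    (h1m : AEStronglyMeasurable (deriv v)) (h1 : Integrable fun ξ => ‖deriv v ξ‖ ^ 2) (x : ℝ) :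
    ‖v x‖ ^ 2 ≤ 2 * (∫ ξ, ‖v ξ‖ ^ 2) + 2 * ∫ ξ, ‖deriv v ξ‖ ^ 2 := by
  have hxx : x ≤ x + 1 := by linarith
  have hi (y z : ℝ) : IntervalIntegrable (deriv v) volume y z := by
    refine IntervalIntegrable.mono_fun' (g := fun ξ => 1 + ‖deriv v ξ‖ ^ 2)
      ((by simp : IntervalIntegrable (fun _ => (1 : ℝ)) volume y z).add h1.intervalIntegrable)
      h1m.restrict (Eventually.of_forall fun ξ => norm_le_one_add_norm_sq _)
  set D := ∫ ξ, ‖deriv v ξ‖ ^ 2 with hD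
  set J := ∫ ξ in x..x + 1, ‖deriv v ξ‖ with hJ
  have hle {g : ℝ → ℝ} (hg : Integrable g) (hg0 : ∀ ξ, 0 ≤ g ξ) :
      ∫ ξ in x..x + 1, g ξ ≤ ∫ ξ, g ξ := by
    rw [intervalIntegral.integral_of_le hxx]
    exact setIntegral_le_integral hg (Eventually.of_forall hg0)
  have hJD : J ^ 2 ≤ D :=
    (sq_intervalIntegral_le (hi _ _).norm h1.intervalIntegrable).trans
      (hle h1 fun ξ => by positivity)
  have hpt : ∀ y ∈ Set.Icc x (x + 1), ‖v x‖ ^ 2 ≤ 2 * ‖v y‖ ^ 2 + 2 * D := by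
    intro y hy
    have hftc : ∫ ξ in x..y, deriv v ξ = v y - v x :=
      intervalIntegral.integral_eq_sub_of_hasDerivAt (fun z _ => (hv z).hasDerivAt) (hi _ _)
    have h2 : ‖v y - v x‖ ≤ J := by
      rw [← hftc]
      refine (intervalIntegral.norm_integral_le_integral_norm hy.1).trans ?_
      exact intervalIntegral.integral_mono_interval le_rfl hy.1 hy.2
        (Eventually.of_forall fun ξ => norm_nonneg _) (hi _ _).norm
    have h3 : ‖v x‖ ≤ ‖v y‖ + J := by
      have := norm_sub_norm_le (v x) (v y)
      rw [norm_sub_rev] at this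
      linarith
    have h4 : ‖v x‖ ^ 2 ≤ (‖v y‖ + J) ^ 2 := by gcongr
    nlinarith [sq_nonneg (‖v y‖ - J)]
  have hint := intervalIntegral.integral_mono_on (μ := volume) hxx
    (f := fun _ => ‖v x‖ ^ 2) (g := fun y => 2 * ‖v y‖ ^ 2 + 2 * D) (by simp)
    ((h0.intervalIntegrable.const_mul 2).add (by simp)) hpt
  rw [intervalIntegral.integral_add (h0.intervalIntegrable.const_mul 2) (by simp),
    intervalIntegral.integral_const_mul] at hint
  simp at hint
  linarith [hle h0 fun ξ => by positivity]

end Sobolev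

lemma L2norm5_nonneg {d : ℕ} (g : ℝ → Fin 5 → Vec d) : 0 ≤ L2norm5 g := Real.sqrt_nonneg _

lemma L2norm5_sq {d : ℕ} (g : ℝ → Fin 5 → Vec d) : L2norm5 g ^ 2 = ∫ ξ, ‖g ξ‖ ^ 2 :=
  Real.sq_sqrt (integral_nonneg fun _ => by positivity)

lemma H1norm5_nonneg {d : ℕ} (g : ℝ → Fin 5 → Vec d) : 0 ≤ H1norm5 g :=
  add_nonneg (L2norm5_nonneg _) (L2norm5_nonneg _)

lemma L2norm5_le_H1norm5 {d : ℕ} (g : ℝ → Fin 5 → Vec d) : L2norm5 g ≤ H1norm5 g :=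
  le_add_of_nonneg_right (L2norm5_nonneg _)

lemma MemH15.norm_le {d : ℕ} {v : ℝ → Fin 5 → Vec d} (hv : MemH15 v) (x : ℝ) :
    ‖v x‖ ≤ 2 * H1norm5 v := by
  have h := norm_sq_le_of_memH1 hv.1 hv.2.1 (measurable_deriv v).aestronglyMeasurable hv.2.2 x
  rw [← L2norm5_sq, ← L2norm5_sq] at h
  refine abs_le_of_sq_le_sq' ?_ (by linarith [H1norm5_nonneg v]) |>.2
  have h0 := L2norm5_nonneg v
  have h1 := L2norm5_nonneg (deriv v)
  unfold H1norm5
  nlinarith [mul_nonneg h0 h1]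

lemma MemH15.memL25_sub {d : ℕ} {v w : ℝ → Fin 5 → Vec d} (hv : MemH15 v) (hw : MemH15 w) :
    MemL25 (fun ξ => v ξ - w ξ) := by
  refine Integrable.mono' ((hv.2.1.const_mul 2).add (hw.2.1.const_mul 2))
    ((hv.1.sub hw.1).continuous.norm.pow 2).aestronglyMeasurable
    (Eventually.of_forall fun ξ => ?_)
  have h : ‖v ξ - w ξ‖ ^ 2 ≤ (‖v ξ‖ + ‖w ξ‖) ^ 2 := by gcongr; exact norm_sub_le _ _
  simp only [norm_pow, norm_norm, Pi.add_apply]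
  nlinarith [sq_nonneg (‖v ξ‖ - ‖w ξ‖)]

lemma L2norm_le_of_norm_le {d : ℕ} {g : Fn d} {p q : ℝ → Fin 5 → Vec d} {A B : ℝ}
    (hA : 0 ≤ A) (hB : 0 ≤ B) (hp : MemL25 p) (hq : MemL25 q)
    (h : ∀ ξ, ‖g ξ‖ ≤ A * ‖p ξ‖ + B * ‖q ξ‖) :
    L2norm g ≤ 2 * (A * L2norm5 p + B * L2norm5 q) := by
  have hp0 := mul_nonneg hA (L2norm5_nonneg p)
  have hq0 := mul_nonneg hB (L2norm5_nonneg q)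
  refine Real.sqrt_le_iff.2 ⟨by positivity, ?_⟩
  have hI : ∫ ξ, ‖g ξ‖ ^ 2 ≤ ∫ ξ, (2 * A ^ 2 * ‖p ξ‖ ^ 2 + 2 * B ^ 2 * ‖q ξ‖ ^ 2) := by
    refine integral_mono_of_nonneg (Eventually.of_forall fun ξ => by positivity)
      ((hp.const_mul _).add (hq.const_mul _)) (Eventually.of_forall fun ξ => ?_)
    have h2 : ‖g ξ‖ ^ 2 ≤ (A * ‖p ξ‖ + B * ‖q ξ‖) ^ 2 := by gcongr; exact h ξ
    simp only
    nlinarith [sq_nonneg (A * ‖p ξ‖ - B * ‖q ξ‖)]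
  rw [integral_add (hp.const_mul _) (hq.const_mul _), integral_const_mul, integral_const_mul,
    ← L2norm5_sq, ← L2norm5_sq] at hI
  nlinarith [mul_nonneg hp0 hq0]

/-- A continuous function on the line with limits at both ends is bounded. -/
lemma exists_norm_le_of_tendsto {E : Type*} [NormedAddCommGroup E] {g : ℝ → E} {a b : E}
    (hg : Continuous g) (ha : Tendsto g atTop (nhds a)) (hb : Tendsto g atBot (nhds b)) :
    ∃ C, ∀ ξ, ‖g ξ‖ ≤ C := by
  obtain ⟨M, hM⟩ := eventually_atTop.1 (ha.norm.eventually_le_const (lt_add_one ‖a‖))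
  obtain ⟨m, hm⟩ := eventually_atBot.1 (hb.norm.eventually_le_const (lt_add_one ‖b‖))
  obtain ⟨C, hC⟩ := (isCompact_Icc (a := m) (b := M)).exists_bound_of_continuousOn hg.continuousOn
  refine ⟨max C (max (‖a‖ + 1) (‖b‖ + 1)), fun ξ => ?_⟩
  rcases le_total M ξ with h | h
  · exact (hM ξ h).trans (by simp)
  rcases le_total ξ m with h' | h'
  · exact (hm ξ h').trans (by simp)
  · exact (hC ξ ⟨h', h⟩).trans (le_max_left _ _)

lemma norm_tau_le {d : ℕ} (σA σB : ℤ) {p : Fn d} {C : ℝ} (hp : ∀ ξ, ‖p ξ‖ ≤ C) (ξ : ℝ) :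
    ‖tau σA σB p ξ‖ ≤ C := by
  rw [pi_norm_le_iff_of_nonneg ((norm_nonneg _).trans (hp 0))]
  intro i
  fin_cases i <;> exact hp _

lemma tau_sub {d : ℕ} (σA σB : ℤ) (p q : Fn d) (ξ : ℝ) :
    tau σA σB p ξ - tau σA σB q ξ = tau σA σB (fun ζ => p ζ - q ζ) ξ := by
  funext i
  fin_cases i <;> rfl

lemma Setting.exists_norm_profile_le {d : ℕ} (S : Setting d) : ∃ C, ∀ ξ, ‖S.Φ ξ‖ ≤ C :=
  exists_norm_le_of_tendsto S.hΦs.continuous S.hΦp S.hΦm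

lemma Setting.exists_norm_deriv_profile_le {d : ℕ} (S : Setting d) :
    ∃ C, ∀ ξ, ‖deriv S.Φ ξ‖ ≤ C := by
  obtain ⟨C, hC⟩ := S.exists_norm_profile_le
  obtain ⟨M, hM⟩ := (isCompact_closedBall (0 : Fin 5 → Vec d) C).exists_bound_of_continuousOn
    S.hf.continuous.continuousOn
  refine ⟨|S.cstar|⁻¹ * M, fun ξ => ?_⟩
  have h := hM _ (mem_closedBall_zero_iff.2 (norm_tau_le S.σA S.σB hC ξ))
  rw [← S.hMFDE, norm_smul, Real.norm_eq_abs] at h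
  rwa [← div_eq_inv_mul, le_div_iff₀' (abs_pos.2 S.hcne)]

lemma Setting.exists_norm_tau_sub_le {d : ℕ} (S : Setting d) :
    ∃ C, 0 ≤ C ∧ ∀ ϑA ϑB ξ : ℝ,
      ‖tau S.σA S.σB (Tshift ϑA S.Φ) ξ - tau S.σA S.σB (Tshift ϑB S.Φ) ξ‖
        ≤ C * |ϑA - ϑB| := by
  obtain ⟨C, hC⟩ := S.exists_norm_deriv_profile_le
  refine ⟨C, (norm_nonneg _).trans (hC 0), fun ϑA ϑB ξ => ?_⟩
  rw [tau_sub]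
  refine norm_tau_le _ _ (fun ζ => ?_) ξ
  have h := convex_univ.norm_image_sub_le_of_norm_deriv_le (𝕜 := ℝ) (f := S.Φ)
    (fun x _ => S.hΦs.differentiable (by simp) x) (fun x _ => hC x)
    (Set.mem_univ (ζ + ϑB)) (Set.mem_univ (ζ + ϑA))
  simpa [Tshift] using h

/-- The Lipschitz estimate for the nonlinearity `N_{f;ϑ}`. -/
lemma exists_Nf_lipschitz {d : ℕ} (S : Setting d) :
    ∃ K > (0 : ℝ), ∀ ϑA ϑB : ℝ, ∀ vtA vtB : ℝ → Fin 5 → Vec d,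
      MemH15 vtA → MemH15 vtB → H1norm5 vtA ≤ 1 → H1norm5 vtB ≤ 1 →
      L2norm (fun ξ => Nf S ϑA vtA ξ - Nf S ϑB vtB ξ) ≤
        K * (H1norm5 vtA + H1norm5 vtB + |ϑA - ϑB|) *
          (L2norm5 (fun ξ => vtA ξ - vtB ξ) + |ϑA - ϑB|) := by
  obtain ⟨C, hC⟩ := S.exists_norm_profile_le
  obtain ⟨M, hM0, hM⟩ := S.exists_norm_tau_sub_le
  have hf2 : ContDiff ℝ 2 S.f := S.hf.of_le (Nat.cast_le (α := WithTop ℕ∞).2 S.hr)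
  obtain ⟨L, hL, hlip⟩ := exists_fderiv_lipschitz_closedBall hf2 (C + 2)
  refine ⟨4 * L * (1 + M) + 1, by positivity, fun ϑA ϑB vA vB hA hB hA1 hB1 => ?_⟩
  have hbase (ϑ ξ : ℝ) : ‖tau S.σA S.σB (Tshift ϑ S.Φ) ξ‖ ≤ C :=
    norm_tau_le _ _ (fun ζ => hC _) ξ
  have hmem (ϑ ξ : ℝ) {v : Fin 5 → Vec d} (hv : ‖v‖ ≤ 2) :
      tau S.σA S.σB (Tshift ϑ S.Φ) ξ + v ∈ closedBall (0 : Fin 5 → Vec d) (C + 2) :=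
    mem_closedBall_zero_iff.2 ((norm_add_le _ _).trans (add_le_add (hbase ϑ ξ) hv))
  have hmem0 (ϑ ξ : ℝ) :
      tau S.σA S.σB (Tshift ϑ S.Φ) ξ ∈ closedBall (0 : Fin 5 → Vec d) (C + 2) :=
    mem_closedBall_zero_iff.2 ((hbase ϑ ξ).trans (by linarith))
  have a0 := H1norm5_nonneg vA
  have b0 := H1norm5_nonneg vB
  have t0 := abs_nonneg (ϑA - ϑB)
  set δ := |ϑA - ϑB|
  have hpt (ξ : ℝ) : ‖Nf S ϑA vA ξ - Nf S ϑB vB ξ‖ ≤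
      (2 * L * (H1norm5 vA + H1norm5 vB)) * ‖vA ξ - vB ξ‖ + (2 * L * M * δ) * ‖vB ξ‖ := by
    have hvA := hA.norm_le ξ
    have hvB := hB.norm_le ξ
    refine (norm_remainder_sub_le (hf2.differentiable two_ne_zero)
      (convex_closedBall (0 : Fin 5 → Vec d) (C + 2)) hL hlip (hmem0 ϑA ξ) (hmem0 ϑB ξ)
      (hmem ϑA ξ (hvA.trans (by linarith))) (hmem ϑA ξ (hvB.trans (by linarith)))
      (hmem ϑB ξ (hvB.trans (by linarith)))).trans (add_le_add ?_ ?_)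
    · calc L * (‖vA ξ‖ + ‖vB ξ‖) * ‖vA ξ - vB ξ‖
          ≤ L * (2 * H1norm5 vA + 2 * H1norm5 vB) * ‖vA ξ - vB ξ‖ := by gcongr
        _ = _ := by ring
    · calc _ ≤ 2 * L * ‖vB ξ‖ * (M * δ) := by gcongr; exact hM ϑA ϑB ξ
        _ = _ := by ring
  refine (L2norm_le_of_norm_le (by positivity) (by positivity) (hA.memL25_sub hB) hB.2.1
    hpt).trans ?_
  have hw0 := L2norm5_nonneg fun ξ => vA ξ - vB ξ
  set W := L2norm5 fun ξ => vA ξ - vB ξ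
  set a := H1norm5 vA
  set b := H1norm5 vB
  calc 2 * (2 * L * (a + b) * W + 2 * L * M * δ * L2norm5 vB)
      ≤ 2 * (2 * L * (a + b) * W + 2 * L * M * δ * b) := by
        gcongr; exact L2norm5_le_H1norm5 vB
    _ = 4 * L * ((a + b) * W) + 4 * L * M * (b * δ) := by ring
    _ ≤ 4 * L * ((a + b + δ) * (W + δ)) + 4 * L * M * ((a + b + δ) * (W + δ)) := by
        have h1 : (a + b) * W ≤ (a + b + δ) * (W + δ) :=
          mul_le_mul (by linarith) (by linarith) hw0 (by positivity)
        have h2 : b * δ ≤ (a + b + δ) * (W + δ) :=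
          mul_le_mul (by linarith) (by linarith) t0 (by positivity)
        gcongr
    _ ≤ (4 * L * (1 + M) + 1) * (a + b + δ) * (W + δ) := by
        have : 0 ≤ (a + b + δ) * (W + δ) := by positivity
        linarith

lemma L2norm5_zero {d : ℕ} : L2norm5 (0 : ℝ → Fin 5 → Vec d) = 0 := by simp [L2norm5]

lemma H1norm5_zero {d : ℕ} : H1norm5 (0 : ℝ → Fin 5 → Vec d) = 0 := by
  simp [H1norm5, L2norm5_zero]

lemma memH15_zero {d : ℕ} : MemH15 (0 : ℝ → Fin 5 → Vec d) :=
  ⟨differentiable_const _, by simp [MemL25], by simp [MemL25]⟩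

lemma Nf_zero {d : ℕ} (S : Setting d) (ϑ ξ : ℝ) : Nf S ϑ 0 ξ = 0 := by simp [Nf]

/-- Lemma 3.2: quadratic and Lipschitz bounds for the
nonlinearity `N_{f;ϑ}`. -/
theorem Nf_bounds {d : ℕ} (S : Setting d) :
    ∃ K > (0 : ℝ),
      (∀ ϑ : ℝ, ∀ vt : ℝ → Fin 5 → Vec d, MemH15 vt → H1norm5 vt ≤ 1 →
        L2norm (Nf S ϑ vt) ≤ K * H1norm5 vt * L2norm5 vt) ∧
      (∀ ϑA ϑB : ℝ, ∀ vtA vtB : ℝ → Fin 5 → Vec d,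
        MemH15 vtA → MemH15 vtB → H1norm5 vtA ≤ 1 → H1norm5 vtB ≤ 1 →
        L2norm (fun ξ => Nf S ϑA vtA ξ - Nf S ϑB vtB ξ) ≤
          K * (H1norm5 vtA + H1norm5 vtB + |ϑA - ϑB|) *
            (L2norm5 (fun ξ => vtA ξ - vtB ξ) + |ϑA - ϑB|)) := by
  obtain ⟨K, hK, h⟩ := exists_Nf_lipschitz S
  refine ⟨K, hK, fun ϑ vt hv hv1 => ?_, h⟩
  simpa [Nf_zero, H1norm5_zero] using
    h ϑ ϑ vt 0 hv memH15_zero hv1 (H1norm5_zero.trans_le zero_le_one)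

end TravellingCorners
end
end

section
/- Assume (Hf), (HΦ) and (HS1) hold, and pick a sufficiently large constant K > 0. Then for any ϑ ∈ ℝ and θ_d ∈ ℝ one has ‖N_{Φ_*;ϑ}(θ_d)‖_{H¹} ≤ K |θ_d|². In addition, for any pair (ϑ^A, ϑ^B) ∈ ℝ² and any pair (θ_d^A, θ_d^B) ∈ ℝ² one has ‖N_{Φ_*;ϑ^A}(θ_d^A) − N_{Φ_*;ϑ^B}(θ_d^B)‖_{H¹} ≤ K [|ϑ^A − ϑ^B| + |θ_d^A| + |θ_d^B|] [|ϑ^A − ϑ^B| + |θ_d^A − θ_d^B|]. -/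
noncomputable section
open MeasureTheory Filter Finset Metric
open scoped Classical

namespace TravellingCorners

open scoped FourierTransform Topology ENNReal

section Fourier

variable {E : Type*} [NormedAddCommGroup E] [InnerProductSpace ℂ E] [CompleteSpace E]

/-- On `L¹ ∩ L²` the Fourier integral agrees almost everywhere with the `L²` Fourier transform. -/
lemma fourier_toLp_ae_eq {f : ℝ → E} (h1 : Integrable f) (h2 : MemLp f 2) :
    (𝓕 (h2.toLp f) : Lp E 2 (volume : Measure ℝ)) =ᵐ[volume] 𝓕 f := by
  have hcont : Continuous (𝓕 f) :=
    VectorFourier.fourierIntegral_continuous Real.continuous_fourierChar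
      (L := innerₗ ℝ) continuous_inner h1
  refine ae_eq_of_integral_contDiff_smul_eq
    ((Lp.memLp _).locallyIntegrable (by norm_num)) hcont.locallyIntegrable ?_
  intro g hg hgs
  let G : ℝ → ℂ := fun x => (g x : ℂ)
  have hGs : HasCompactSupport G := hgs.comp_left (g := fun x : ℝ => (x : ℂ)) (by simp)
  have hG : ContDiff ℝ (⊤ : ℕ∞) G := Complex.ofRealCLM.contDiff.comp hg
  let Gs : SchwartzMap ℝ ℂ := hGs.toSchwartzMap hG
  have key := congrArg (fun T : TemperedDistribution ℝ E => T Gs)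
    (Lp.fourier_toTemperedDistribution_eq (h2.toLp f))
  simp only [TemperedDistribution.fourier_apply, Lp.toTemperedDistribution_apply] at key
  have hGs_apply : ∀ x, Gs x = (g x : ℂ) := fun x => rfl
  simp only [hGs_apply] at key
  have hsm : ∀ (x : ℝ) (v : E), ((g x : ℝ) : ℂ) • v = g x • v := fun x v => by
    simp
  simp only [hsm] at key
  rw [← key]
  have hswap := VectorFourier.integral_fourierIntegral_smul_eq_flip (L := innerₗ ℝ)
    (μ := (volume : Measure ℝ)) (ν := (volume : Measure ℝ))
    Real.continuous_fourierChar continuous_inner Gs.integrable h1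
  have : ∫ x, (𝓕 Gs) x • (h2.toLp f : Lp E 2 (volume : Measure ℝ)) x = ∫ x, (𝓕 Gs) x • f x := by
    refine integral_congr_ae ?_
    filter_upwards [h2.coeFn_toLp] with x hx
    rw [hx]
  rw [this]
  simp only [← hsm]
  simpa using! hswap

/-- Plancherel's theorem for the Fourier integral on `L¹ ∩ L²`. -/
lemma eLpNorm_fourier {f : ℝ → E} (h1 : Integrable f) (h2 : MemLp f 2) :
    eLpNorm (𝓕 f) 2 volume = eLpNorm f 2 volume := by
  rw [← eLpNorm_congr_ae (fourier_toLp_ae_eq h1 h2), ← eLpNorm_congr_ae h2.coeFn_toLp,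
    ← Lp.enorm_def, ← Lp.enorm_def, ← ofReal_norm, ← ofReal_norm, Lp.norm_fourier_eq]

variable {ι : Type*} [Fintype ι]

/-- The symbol of the constant coefficient operator `q ↦ -c q' + ∑ j, A j (q (· + s j))`. -/
def symbol (c : ℝ) (A : ι → E →L[ℂ] E) (s : ι → ℝ) (ν : ℝ) : E →L[ℂ] E :=
  (-(c : ℂ) * (Complex.I * ν)) • ContinuousLinearMap.id ℂ E
    + ∑ j, Complex.exp (Complex.I * ν * s j) • A j

omit [CompleteSpace E] in
lemma fourier_add_shift (q : ℝ → E) (s w : ℝ) :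
    𝓕 (fun ξ => q (ξ + s)) w = Complex.exp (Complex.I * (2 * Real.pi * w : ℝ) * s) • 𝓕 q w := by
  have := congrFun (VectorFourier.fourierIntegral_comp_add_right Real.fourierChar
    (volume : Measure ℝ) (innerₗ ℝ) q s) w
  refine Eq.trans this ?_
  rw [Circle.smul_def, Real.fourierChar_apply]
  congr 2
  simp
  ring

lemma fourier_constCoeff {c : ℝ} {A : ι → E →L[ℂ] E} {s : ι → ℝ} {q : ℝ → E}
    (hd : Differentiable ℝ q) (hq : Integrable q) (hq' : Integrable (deriv q)) (w : ℝ) :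
    𝓕 (fun ξ => -(c • deriv q ξ) + ∑ j, A j (q (ξ + s j))) w
      = symbol c A s (2 * Real.pi * w) (𝓕 q w) := by
  have hcomp : ∀ f : ℝ → E, Integrable f →
      Integrable (fun v => Real.fourierChar (-inner ℝ v w) • f v) := fun f hf =>
    (Real.fourierIntegral_convergent_iff w).2 hf
  have hsh : ∀ j, Integrable (fun ξ => A j (q (ξ + s j))) := fun j =>
    (A j).integrable_comp (hq.comp_add_right (s j))
  have hA : ∀ j, 𝓕 (fun ξ => A j (q (ξ + s j))) w = A j (𝓕 (fun ξ => q (ξ + s j)) w) := by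
    intro j
    rw [Real.fourier_eq, Real.fourier_eq,
      ← ContinuousLinearMap.integral_comp_comm _ (hcomp _ (hq.comp_add_right (s j)))]
    simp [Circle.smul_def]
  have hder := congrFun (Real.fourier_deriv hq hd hq') w
  have h1 : 𝓕 (fun ξ => -(c • deriv q ξ) + ∑ j, A j (q (ξ + s j))) w
      = -(c • 𝓕 (deriv q) w) + ∑ j, 𝓕 (fun ξ => A j (q (ξ + s j))) w := by
    simp only [Real.fourier_eq]
    rw [← integral_finsetSum _ (fun j _ => hcomp _ (hsh j)), ← integral_smul, ← integral_neg,
      ← integral_add (f := fun v => -(c • Real.fourierChar (-inner ℝ v w) • deriv q v))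
        ((hcomp _ hq').smul c).neg (integrable_finsetSum _ fun j _ => hcomp _ (hsh j))]
    refine integral_congr_ae (ae_of_all _ fun v => ?_)
    simp [smul_add, smul_sum, smul_comm c]
  rw [h1, hder]
  simp only [hA, fourier_add_shift, symbol, _root_.add_apply,
    _root_.sum_apply, _root_.smul_apply, map_smul,
    ContinuousLinearMap.id_apply]
  congr 1
  rw [← neg_smul, ← Complex.coe_smul, smul_smul]
  congr 1
  push_cast
  ring

omit [CompleteSpace E] in
/-- A symbol that is injective on the imaginary axis is uniformly bounded below there. -/
lemma exists_symbol_lower_bound [FiniteDimensional ℂ E] {c : ℝ} (hc : c ≠ 0)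
    {A : ι → E →L[ℂ] E} {s : ι → ℝ} (h : ∀ ν v, symbol c A s ν v = 0 → v = 0) :
    ∃ C > 0, ∀ ν v, ‖v‖ ≤ C * ‖symbol c A s ν v‖ := by
  have : ProperSpace E := FiniteDimensional.proper ℂ E
  set a := ∑ j, ‖A j‖ with ha
  have ha0 : 0 ≤ a := Finset.sum_nonneg fun _ _ => norm_nonneg _
  have hc0 : 0 < |c| := abs_pos.2 hc
  set N := (a + 1) / |c| with hN
  have hlarge : ∀ ν, N ≤ |ν| → ∀ v, ‖v‖ ≤ ‖symbol c A s ν v‖ := by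
    intro ν hν v
    have h1 : ‖∑ j, Complex.exp (Complex.I * ν * s j) • A j v‖ ≤ a * ‖v‖ := by
      refine (norm_sum_le _ _).trans ?_
      rw [ha, Finset.sum_mul]
      refine Finset.sum_le_sum fun j _ => ?_
      rw [norm_smul, show Complex.I * ν * s j = ((ν * s j : ℝ) : ℂ) * Complex.I by
        push_cast; ring, Complex.norm_exp_ofReal_mul_I, one_mul]
      exact (A j).le_opNorm v
    have h2 : ‖(-(c : ℂ) * (Complex.I * ν)) • v‖ = |c| * |ν| * ‖v‖ := by
      rw [norm_smul]; simp
    have h3 : a + 1 ≤ |c| * |ν| := by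
      rw [hN, div_le_iff₀ hc0] at hν; linarith
    have h4 : symbol c A s ν v = (-(c : ℂ) * (Complex.I * ν)) • v
        + ∑ j, Complex.exp (Complex.I * ν * s j) • A j v := by
      simp [symbol]
    have h5 := norm_sub_le_norm_add ((-(c : ℂ) * (Complex.I * ν)) • v)
      (∑ j, Complex.exp (Complex.I * ν * s j) • A j v)
    rw [h4]
    nlinarith [norm_nonneg v]
  have hcomp : IsCompact (Set.Icc (-N) N ×ˢ sphere (0 : E) 1) :=
    isCompact_Icc.prod (isCompact_sphere _ _)
  have hcont : Continuous fun x : ℝ × E => ‖symbol c A s x.1 x.2‖ := by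
    simp only [symbol, _root_.add_apply, _root_.sum_apply,
      _root_.smul_apply, ContinuousLinearMap.id_apply]
    fun_prop
  obtain ⟨m, hm, hmle⟩ : ∃ m > 0, ∀ x ∈ Set.Icc (-N) N ×ˢ sphere (0 : E) 1,
      m ≤ ‖symbol c A s x.1 x.2‖ := by
    rcases (Set.Icc (-N) N ×ˢ sphere (0 : E) 1).eq_empty_or_nonempty with he | hne
    · exact ⟨1, one_pos, by simp [he]⟩
    · obtain ⟨x, hx, hmin⟩ := hcomp.exists_isMinOn hne hcont.continuousOn
      refine ⟨_, norm_pos_iff.2 fun h0 => ?_, fun y hy => hmin hy⟩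
      have hx2 : ‖x.2‖ = 1 := by simpa using hx.2
      simp [h _ _ h0] at hx2
  refine ⟨1 + m⁻¹, by positivity, fun ν v => ?_⟩
  rcases le_total N |ν| with hν | hν
  · have := hlarge ν hν v
    have : 0 ≤ m⁻¹ * ‖symbol c A s ν v‖ := by positivity
    linarith
  · rcases eq_or_ne v 0 with rfl | hv
    · simp
    have hv' : 0 < ‖v‖ := norm_pos_iff.2 hv
    have := hmle (ν, ((‖v‖⁻¹ : ℝ) : ℂ) • v)
      ⟨abs_le.1 hν, by simp [norm_smul, hv'.ne']⟩
    simp only [map_smul, norm_smul, Complex.norm_real, norm_inv, norm_norm] at this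
    rw [inv_mul_eq_div, le_div_iff₀ hv'] at this
    have h6 : ‖v‖ ≤ m⁻¹ * ‖symbol c A s ν v‖ := by
      rw [inv_mul_eq_div, le_div_iff₀ hm]; linarith
    linarith [norm_nonneg (symbol c A s ν v)]

/-- Coercivity in `L²` of a constant coefficient operator with invertible symbol. -/
lemma eLpNorm_le_of_symbol_lower_bound {c C : ℝ} {A : ι → E →L[ℂ] E} {s : ι → ℝ}
    (hC : ∀ ν v, ‖v‖ ≤ C * ‖symbol c A s ν v‖) {q : ℝ → E} (hd : Differentiable ℝ q)
    (hq : Integrable q) (hq' : Integrable (deriv q)) (hq2 : MemLp q 2)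
    (hq2' : MemLp (deriv q) 2) :
    eLpNorm q 2 volume ≤ ENNReal.ofReal C *
      eLpNorm (fun ξ => -(c • deriv q ξ) + ∑ j, A j (q (ξ + s j))) 2 volume := by
  have hg1 : Integrable (fun ξ => -(c • deriv q ξ) + ∑ j, A j (q (ξ + s j))) :=
    (hq'.smul c).neg.add
      (integrable_finsetSum _ fun j _ => (A j).integrable_comp (hq.comp_add_right (s j)))
  have hg2 : MemLp (fun ξ => -(c • deriv q ξ) + ∑ j, A j (q (ξ + s j))) 2 :=
    (hq2'.const_smul c).neg.add (memLp_finsetSum _ fun j _ =>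
      (A j).comp_memLp' (hq2.comp_measurePreserving (measurePreserving_add_right volume (s j))))
  rw [← eLpNorm_fourier hq hq2, ← eLpNorm_fourier hg1 hg2]
  refine eLpNorm_le_mul_eLpNorm_of_ae_le_mul (ae_of_all _ fun w => ?_) 2
  rw [fourier_constCoeff hd hq hq']
  exact hC _ _

end Fourier

section Decay

variable {E : Type*} [NormedAddCommGroup E] [InnerProductSpace ℂ E] [FiniteDimensional ℂ E]

lemma exists_deriv_smoothTransition_bound : ∃ D, ∀ x, |deriv Real.smoothTransition x| ≤ D := by
  have hc : Continuous (deriv Real.smoothTransition) :=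
    (Real.smoothTransition.contDiff (n := 1)).continuous_deriv le_rfl
  obtain ⟨D, hD⟩ := (isCompact_Icc (a := (0 : ℝ)) (b := 1)).exists_bound_of_continuousOn
    hc.continuousOn
  refine ⟨max D 0, fun x => ?_⟩
  rcases lt_or_ge x 0 with hx | hx
  · have : Real.smoothTransition =ᶠ[𝓝 x] fun _ => 0 := by
      filter_upwards [Iio_mem_nhds hx] with y hy
      exact Real.smoothTransition.zero_of_nonpos (le_of_lt hy)
    simp [this.deriv_eq]
  rcases lt_or_ge 1 x with hx1 | hx1
  · have : Real.smoothTransition =ᶠ[𝓝 x] fun _ => 1 := by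
      filter_upwards [Ioi_mem_nhds hx1] with y hy
      exact Real.smoothTransition.one_of_one_le (le_of_lt hy)
    simp [this.deriv_eq]
  · exact (hD x ⟨hx, hx1⟩).trans (le_max_left _ _)

lemma integrable_and_memLp_two_of_exp_bound {F : Type*} [NormedAddCommGroup F] {f : ℝ → F}
    {R B ε : ℝ} (hε : 0 < ε) (hf : Continuous f) (h0 : ∀ ξ ≤ R, f ξ = 0)
    (hB : ∀ ξ, ‖f ξ‖ ≤ B * Real.exp (-ε * ξ)) : Integrable f ∧ MemLp f 2 := by
  have hi : Integrable f := by
    rw [← integrableOn_iff_integrable_of_support_subset (s := Set.Ioi R)]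
    · exact ((exp_neg_integrableOn_Ioi R hε).const_mul B).mono' hf.aestronglyMeasurable
        (ae_of_all _ hB)
    · intro x hx
      by_contra hx'
      exact hx (h0 x (not_lt.1 hx'))
  refine ⟨hi, (memLp_two_iff_integrable_sq_norm hf.aestronglyMeasurable).2 ?_⟩
  refine (hi.norm.const_mul (|B| * Real.exp (-ε * R))).mono'
    (by fun_prop) (ae_of_all _ fun ξ => ?_)
  rw [Real.norm_of_nonneg (by positivity), sq]
  refine mul_le_mul_of_nonneg_right ?_ (norm_nonneg _)
  rcases le_or_gt ξ R with h | h
  · rw [h0 ξ h]; simp; positivity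
  · refine (hB ξ).trans ?_
    refine mul_le_mul (le_abs_self B) (Real.exp_le_exp.2 ?_) (by positivity) (by positivity)
    nlinarith

/-- The function `p`, cut off to the left of `R` and multiplied by `exp (-ε ξ)`. -/
def weighted (R : ℝ) (p : ℝ → E) (ε ξ : ℝ) : E :=
  (Real.smoothTransition (ξ - R) * Real.exp (-ε * ξ)) • p ξ

variable {p : ℝ → E} {R : ℝ}

omit [FiniteDimensional ℂ E] in
lemma hasDerivAt_weighted (hp : ContDiff ℝ 1 p) (ε ξ : ℝ) :
    HasDerivAt (weighted R p ε)
      ((deriv Real.smoothTransition (ξ - R) * Real.exp (-ε * ξ)) • p ξ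
        + (-ε) • weighted R p ε ξ
        + (Real.smoothTransition (ξ - R) * Real.exp (-ε * ξ)) • deriv p ξ) ξ := by
  have h1 : HasDerivAt (fun x => Real.smoothTransition (x - R))
      (deriv Real.smoothTransition (ξ - R)) ξ := by
    have := ((Real.smoothTransition.contDiff (n := 1)).differentiable one_ne_zero
      (ξ - R)).hasDerivAt.comp_sub_const ξ R
    exact this
  have h2 : HasDerivAt (fun x => Real.exp (-ε * x)) (Real.exp (-ε * ξ) * (-ε)) ξ := by
    simpa using ((hasDerivAt_id ξ).const_mul (-ε)).exp
  have h3 := (hp.differentiable one_ne_zero ξ).hasDerivAt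
  refine ((h1.mul h2).smul h3).congr_deriv ?_
  simp only [weighted, smul_smul, add_smul, Pi.mul_apply]
  rw [add_comm]
  congr 3
  ring

omit [FiniteDimensional ℂ E] in
lemma weighted_of_le (ε : ℝ) {ξ : ℝ} (h : ξ ≤ R) : weighted R p ε ξ = 0 := by
  simp [weighted, Real.smoothTransition.zero_of_nonpos (sub_nonpos.2 h)]

omit [FiniteDimensional ℂ E] in
lemma deriv_weighted_of_lt (ε : ℝ) {ξ : ℝ} (h : ξ < R) : deriv (weighted R p ε) ξ = 0 := by
  have : weighted R p ε =ᶠ[𝓝 ξ] fun _ => 0 := by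
    filter_upwards [Iio_mem_nhds h] with y hy
    exact weighted_of_le ε (le_of_lt hy)
  simp [this.deriv_eq]

omit [FiniteDimensional ℂ E] in
lemma weighted_of_ge (ε : ℝ) {ξ : ℝ} (h : R + 1 ≤ ξ) :
    weighted R p ε ξ = Real.exp (-ε * ξ) • p ξ := by
  simp [weighted, Real.smoothTransition.one_of_one_le (show 1 ≤ ξ - R by linarith)]

omit [FiniteDimensional ℂ E] in
lemma continuous_deriv_weighted (hp : ContDiff ℝ 1 p) :
    Continuous fun x : ℝ × ℝ => deriv (weighted R p x.1) x.2 := by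
  have h1 : Continuous (deriv Real.smoothTransition) :=
    (Real.smoothTransition.contDiff (n := 1)).continuous_deriv le_rfl
  have h2 := hp.continuous_deriv le_rfl
  have h3 := hp.continuous
  have h4 := Real.smoothTransition.continuous
  simp only [(hasDerivAt_weighted hp _ _).deriv, weighted]
  fun_prop

omit [FiniteDimensional ℂ E] in
lemma continuous_weighted (hp : ContDiff ℝ 1 p) :
    Continuous fun x : ℝ × ℝ => weighted R p x.1 x.2 := by
  have h3 := hp.continuous
  have h4 := Real.smoothTransition.continuous
  simp only [weighted]
  fun_prop

variable {B B' : ℝ}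

omit [FiniteDimensional ℂ E] in
lemma norm_weighted_le (hB : ∀ ξ, ‖p ξ‖ ≤ B) (ε ξ : ℝ) :
    ‖weighted R p ε ξ‖ ≤ B * Real.exp (-ε * ξ) := by
  rw [weighted, norm_smul, norm_mul, Real.norm_of_nonneg (Real.smoothTransition.nonneg _),
    Real.norm_of_nonneg (Real.exp_pos _).le, mul_comm B]
  refine mul_le_mul ?_ (hB ξ) (norm_nonneg _) (Real.exp_pos _).le
  exact mul_le_of_le_one_left (Real.exp_pos _).le (Real.smoothTransition.le_one _)

omit [FiniteDimensional ℂ E] in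
lemma norm_deriv_weighted_le (hp : ContDiff ℝ 1 p) (hB : ∀ ξ, ‖p ξ‖ ≤ B)
    (hB' : ∀ ξ, ‖deriv p ξ‖ ≤ B') {D : ℝ} (hD : ∀ x, |deriv Real.smoothTransition x| ≤ D)
    {ε : ℝ} (hε : 0 ≤ ε) (ξ : ℝ) :
    ‖deriv (weighted R p ε) ξ‖ ≤ (D * B + ε * B + B') * Real.exp (-ε * ξ) := by
  rw [(hasDerivAt_weighted hp ε ξ).deriv]
  refine (norm_add₃_le).trans ?_
  have he := Real.exp_pos (-ε * ξ)
  have h1 : ‖(deriv Real.smoothTransition (ξ - R) * Real.exp (-ε * ξ)) • p ξ‖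
      ≤ D * Real.exp (-ε * ξ) * B := by
    rw [norm_smul, norm_mul, Real.norm_of_nonneg he.le, Real.norm_eq_abs]
    have hD0 : 0 ≤ D := (abs_nonneg _).trans (hD 0)
    exact mul_le_mul (mul_le_mul_of_nonneg_right (hD _) he.le) (hB ξ) (norm_nonneg _)
      (by positivity)
  have h2 : ‖(-ε) • weighted R p ε ξ‖ ≤ ε * (B * Real.exp (-ε * ξ)) := by
    rw [norm_smul, norm_neg, Real.norm_of_nonneg hε]
    exact mul_le_mul_of_nonneg_left (norm_weighted_le hB ε ξ) hε
  have h3 := norm_weighted_le (R := R) (p := deriv p) hB' ε ξ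
  rw [weighted] at h3
  linarith

variable {ι : Type*} [Fintype ι]

omit [FiniteDimensional ℂ E] in
lemma norm_residual_weighted_le {c δ ε ξ : ℝ} {A : ι → ℝ → E →L[ℂ] E} {A' : ι → E →L[ℂ] E}
    {s : ι → ℝ} (hp : ContDiff ℝ 1 p) (heq : c • deriv p ξ = ∑ j, A j ξ (p (ξ + s j)))
    (hε : 0 ≤ ε) (hcε : |c| * ε ≤ δ) (hclose : ∀ j, ‖A' j - Real.exp (ε * s j) • A j ξ‖ ≤ δ)
    (hgt : R + 1 < ξ) (hgts : ∀ j, R + 1 ≤ ξ + s j) :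
    ‖-(c • deriv (weighted R p ε) ξ) + ∑ j, A' j (weighted R p ε (ξ + s j))‖
      ≤ δ * (‖weighted R p ε ξ‖ + ∑ j, ‖weighted R p ε (ξ + s j)‖) := by
  have hder : deriv (weighted R p ε) ξ
      = (-ε) • weighted R p ε ξ + Real.exp (-ε * ξ) • deriv p ξ := by
    have hev : weighted R p ε =ᶠ[𝓝 ξ] fun x => Real.exp (-ε * x) • p x := by
      filter_upwards [Ioi_mem_nhds hgt] with y hy
      exact weighted_of_ge ε (le_of_lt hy)
    have h2 : HasDerivAt (fun x => Real.exp (-ε * x)) (Real.exp (-ε * ξ) * (-ε)) ξ := by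
      simpa using ((hasDerivAt_id ξ).const_mul (-ε)).exp
    have h3 : HasDerivAt (fun x => Real.exp (-ε * x) • p x) _ ξ :=
      h2.smul (hp.differentiable one_ne_zero ξ).hasDerivAt
    rw [hev.deriv_eq, h3.deriv, weighted_of_ge ε hgt.le, smul_smul, add_comm,
      mul_comm (Real.exp _) (-ε)]
  have hshift : ∀ j, Real.exp (-ε * ξ) • p (ξ + s j)
      = Real.exp (ε * s j) • weighted R p ε (ξ + s j) := by
    intro j
    rw [weighted_of_ge ε (hgts j), smul_smul, ← Real.exp_add]
    congr 2
    ring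
  set q := weighted R p ε
  have hform : -(c • deriv q ξ) + ∑ j, A' j (q (ξ + s j)) = (c * ε) • q ξ
      + ∑ j, (A' j - Real.exp (ε * s j) • A j ξ) (q (ξ + s j)) := by
    have h3 : c • Real.exp (-ε * ξ) • deriv p ξ
        = ∑ j, Real.exp (ε * s j) • A j ξ (q (ξ + s j)) := by
      rw [smul_comm, heq, Finset.smul_sum]
      refine Finset.sum_congr rfl fun j _ => ?_
      have hlin : ∀ (t : ℝ) (v : E), A j ξ (t • v) = t • A j ξ v := fun t v => by
        rw [← Complex.coe_smul, map_smul, Complex.coe_smul]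
      rw [← hlin, hshift, hlin]
    simp only [hder, smul_add, h3, _root_.sub_apply, _root_.smul_apply,
      Finset.sum_sub_distrib, smul_smul]
    rw [mul_neg, neg_smul]
    abel
  rw [hform]
  refine (norm_add_le _ _).trans ?_
  rw [mul_add]
  refine add_le_add ?_ ((norm_sum_le _ _).trans ?_)
  · rw [norm_smul, norm_mul, Real.norm_eq_abs, Real.norm_of_nonneg hε]
    exact mul_le_mul_of_nonneg_right hcε (norm_nonneg _)
  · rw [Finset.mul_sum]
    refine Finset.sum_le_sum fun j _ => (ContinuousLinearMap.le_opNorm _ _).trans ?_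
    exact mul_le_mul_of_nonneg_right (hclose j) (norm_nonneg _)

lemma eLpNorm_two_le_of_norm_le_shifts {F G : Type*} [NormedAddCommGroup F]
    [NormedAddCommGroup G] {q : ℝ → F} {g : ℝ → G} {φ : ℝ → ℝ} {δ : ℝ} {s : ι → ℝ} (hδ0 : 0 ≤ δ)
    (hqc : Continuous q) (hφ : AEStronglyMeasurable φ)
    (hbound : ∀ ξ, ‖g ξ‖ ≤ φ ξ + δ * (‖q ξ‖ + ∑ j, ‖q (ξ + s j)‖)) :
    eLpNorm g 2 volume
      ≤ eLpNorm φ 2 volume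
        + ENNReal.ofReal (δ * (((Fintype.card ι : ℕ) : ℝ) + 1)) * eLpNorm q 2 volume := by
  have hsh : ∀ j, eLpNorm (fun ξ => ‖q (ξ + s j)‖) 2 volume = eLpNorm q 2 volume := fun j => by
    rw [eLpNorm_norm]
    exact eLpNorm_comp_measurePreserving hqc.aestronglyMeasurable
      (measurePreserving_add_right volume (s j))
  have h2 : eLpNorm (fun ξ => ∑ j, ‖q (ξ + s j)‖) 2 volume
      ≤ (Fintype.card ι : ENNReal) * eLpNorm q 2 volume := by
    have h2 := eLpNorm_sum_le (μ := (volume : Measure ℝ)) (p := 2) (s := Finset.univ)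
      (f := fun (j : ι) ξ => ‖q (ξ + s j)‖)
      (fun j _ => Continuous.aestronglyMeasurable (by fun_prop)) (by norm_num)
    have h3 : (∑ j, fun ξ => ‖q (ξ + s j)‖) = fun ξ => ∑ j, ‖q (ξ + s j)‖ := by
      ext ξ; simp
    simp only [h3, hsh, Finset.sum_const, Finset.card_univ, nsmul_eq_mul] at h2
    exact h2
  have h1 : eLpNorm (fun ξ => ‖q ξ‖ + ∑ j, ‖q (ξ + s j)‖) 2 volume
      ≤ ENNReal.ofReal (((Fintype.card ι : ℕ) : ℝ) + 1) * eLpNorm q 2 volume := by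
    refine (eLpNorm_add_le (f := fun ξ => ‖q ξ‖) (g := fun ξ => ∑ j, ‖q (ξ + s j)‖)
      (Continuous.aestronglyMeasurable (by fun_prop))
      (Continuous.aestronglyMeasurable (by fun_prop)) (by norm_num)).trans ?_
    rw [eLpNorm_norm, ENNReal.ofReal_add (Nat.cast_nonneg _) zero_le_one, ENNReal.ofReal_natCast,
      ENNReal.ofReal_one, add_mul, one_mul, add_comm]
    exact add_le_add h2 le_rfl
  refine (eLpNorm_mono_real hbound).trans ?_
  refine (eLpNorm_add_le (f := φ) (g := fun ξ => δ * (‖q ξ‖ + ∑ j, ‖q (ξ + s j)‖)) hφ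
    (Continuous.aestronglyMeasurable (by fun_prop)) (by norm_num)).trans ?_
  refine add_le_add le_rfl ?_
  have h4 : eLpNorm (fun ξ => δ * (‖q ξ‖ + ∑ j, ‖q (ξ + s j)‖)) 2 volume
      = ‖δ‖ₑ * eLpNorm (fun ξ => ‖q ξ‖ + ∑ j, ‖q (ξ + s j)‖) 2 volume :=
    eLpNorm_const_smul δ (fun ξ => ‖q ξ‖ + ∑ j, ‖q (ξ + s j)‖) 2 volume
  rw [h4, ENNReal.ofReal_mul hδ0, mul_assoc, Real.enorm_of_nonneg hδ0]
  exact mul_le_mul_right h1 _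

/-- A bounded solution of a functional differential equation whose coefficients converge at `+∞`
to a system with invertible symbol is square integrable near `+∞`. -/
lemma exists_memLp_two_Ici {c : ℝ} {A : ι → ℝ → E →L[ℂ] E} {A' : ι → E →L[ℂ] E} {s : ι → ℝ}
    (hc : c ≠ 0) (hA : ∀ j, Tendsto (A j) atTop (𝓝 (A' j)))
    (hsym : ∀ ν v, symbol c A' s ν v = 0 → v = 0)
    (hp : ContDiff ℝ 1 p) (hB : ∀ ξ, ‖p ξ‖ ≤ B) (hB' : ∀ ξ, ‖deriv p ξ‖ ≤ B')
    (heq : ∀ ξ, c • deriv p ξ = ∑ j, A j ξ (p (ξ + s j))) :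
    ∃ R, MemLp p 2 (volume.restrict (Set.Ici R)) := by
  have : CompleteSpace E := FiniteDimensional.complete ℂ E
  obtain ⟨C, hC0, hC⟩ := exists_symbol_lower_bound hc hsym
  set n : ℝ := ((Fintype.card ι : ℕ) : ℝ) with hn
  have hn0 : 0 ≤ n := Nat.cast_nonneg _
  set δ : ℝ := 1 / (2 * C * (n + 1)) with hδ
  have hδ0 : 0 < δ := by positivity
  set S := ∑ j, |s j| with hS
  have hsS : ∀ j, |s j| ≤ S := fun j =>
    Finset.single_le_sum (f := fun j => |s j|) (fun _ _ => abs_nonneg _) (Finset.mem_univ j)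
  have hS0 : 0 ≤ S := Finset.sum_nonneg fun _ _ => abs_nonneg _
  have hclose : ∀ᶠ x : ℝ × ℝ in 𝓝 0 ×ˢ atTop,
      ∀ j, ‖A' j - Real.exp (x.1 * s j) • A j x.2‖ ≤ δ := by
    refine eventually_all.2 fun j => ?_
    have h1 : Tendsto (fun x : ℝ × ℝ => Real.exp (x.1 * s j)) (𝓝 0 ×ˢ atTop) (𝓝 1) := by
      have : Tendsto (fun t : ℝ => Real.exp (t * s j)) (𝓝 0) (𝓝 1) := by
        have : Continuous fun t : ℝ => Real.exp (t * s j) := by fun_prop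
        simpa using this.tendsto 0
      exact this.comp tendsto_fst
    have h2 := (h1.smul ((hA j).comp tendsto_snd)).const_sub (A' j)
    rw [one_smul, sub_self] at h2
    have h3 := h2.norm
    rw [norm_zero] at h3
    exact h3.eventually (eventually_le_nhds hδ0)
  obtain ⟨pa, hpa, pb, hpb, hab⟩ := eventually_prod_iff.1 hclose
  obtain ⟨R, hR⟩ := eventually_atTop.1 hpb
  set g : ℝ → ℝ → E := fun ε ξ =>
    -(c • deriv (weighted R p ε) ξ) + ∑ j, A' j (weighted R p ε (ξ + s j)) with hg
  have hgcont : Continuous fun x : ℝ × ℝ => g x.1 x.2 := by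
    have h1 := continuous_deriv_weighted (R := R) hp
    have h2 : ∀ j, Continuous fun x : ℝ × ℝ => weighted R p x.1 (x.2 + s j) := fun j =>
      (continuous_weighted (R := R) hp).comp (by fun_prop : Continuous fun x : ℝ × ℝ =>
        (x.1, x.2 + s j))
    simp only [hg]
    fun_prop
  set I := Set.Icc (R - S) (R + 1 + S) with hI
  obtain ⟨M, hM⟩ := ((isCompact_Icc (a := (0 : ℝ)) (b := 1)).prod
    (isCompact_Icc (a := R - S) (b := R + 1 + S))).exists_bound_of_continuousOn
    hgcont.continuousOn
  set b := eLpNorm (I.indicator fun _ : ℝ => M) 2 volume with hb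
  have hbtop : b ≠ ⊤ :=
    (memLp_indicator_const 2 measurableSet_Icc M (Or.inr (by simp))).eLpNorm_ne_top
  obtain ⟨D, hD⟩ := exists_deriv_smoothTransition_bound
  have hgood : ∀ᶠ ε : ℝ in 𝓝 0, pa ε ∧ ε ≤ 1 ∧ |c| * ε ≤ δ := by
    refine hpa.and ((eventually_le_nhds one_pos).and ?_)
    have : Tendsto (fun ε : ℝ => |c| * ε) (𝓝 0) (𝓝 0) := by
      have : Continuous fun ε : ℝ => |c| * ε := by fun_prop
      simpa using this.tendsto 0
    exact this.eventually (eventually_le_nhds hδ0)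
  have hmain : ∀ ε, 0 < ε → (pa ε ∧ ε ≤ 1 ∧ |c| * ε ≤ δ) →
      eLpNorm (weighted R p ε) 2 volume ≤ 2 * (ENNReal.ofReal C * b) := by
    rintro ε hε ⟨hpaε, hε1, hcε⟩
    have hqc : Continuous (weighted R p ε) :=
      (continuous_weighted (R := R) hp).comp (by fun_prop : Continuous fun x : ℝ => (ε, x))
    have hq'c : Continuous (deriv (weighted R p ε)) :=
      (continuous_deriv_weighted (R := R) hp).comp (by fun_prop : Continuous fun x : ℝ => (ε, x))
    obtain ⟨hq1, hq2⟩ := integrable_and_memLp_two_of_exp_bound hε hqc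
      (fun ξ hξ => weighted_of_le ε hξ) (norm_weighted_le hB ε)
    obtain ⟨hq1', hq2'⟩ := integrable_and_memLp_two_of_exp_bound (R := R - 1) hε hq'c
      (fun ξ hξ => deriv_weighted_of_lt ε (by linarith))
      (norm_deriv_weighted_le hp hB hB' hD hε.le)
    have hcoer := eLpNorm_le_of_symbol_lower_bound hC
      (fun ξ => (hasDerivAt_weighted hp ε ξ).differentiableAt) hq1 hq1' hq2 hq2'
    set q := weighted R p ε with hq
    set a := eLpNorm q 2 volume with ha
    have hbound : ∀ ξ, ‖g ε ξ‖ ≤ I.indicator (fun _ => M) ξ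
        + δ * (‖q ξ‖ + ∑ j, ‖q (ξ + s j)‖) := by
      intro ξ
      have hnn : 0 ≤ δ * (‖q ξ‖ + ∑ j, ‖q (ξ + s j)‖) := by positivity
      by_cases hξI : ξ ∈ I
      · rw [Set.indicator_of_mem hξI]
        have := hM (ε, ξ) ⟨⟨hε.le, hε1⟩, hξI⟩
        simp only at this
        linarith
      rw [Set.indicator_of_notMem hξI, zero_add]
      rcases lt_or_ge ξ (R - S) with hlt | hge
      · have h1 : ∀ j, q (ξ + s j) = 0 := fun j =>
          weighted_of_le ε (by linarith [le_abs_self (s j), hsS j])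
        have h2 : deriv q ξ = 0 := deriv_weighted_of_lt ε (by linarith)
        have : g ε ξ = 0 := by simp [hg, ← hq, h1, h2]
        rw [this, norm_zero]
        exact hnn
      · have hgt : R + 1 + S < ξ := by
          by_contra hcon
          exact hξI ⟨hge, not_lt.1 hcon⟩
        exact norm_residual_weighted_le hp (heq ξ) hε.le hcε (hab hpaε (hR ξ (by linarith)))
          (by linarith) fun j => by linarith [neg_abs_le (s j), hsS j]
    have hgle : eLpNorm (g ε) 2 volume ≤ b + ENNReal.ofReal (δ * (n + 1)) * a :=
      eLpNorm_two_le_of_norm_le_shifts hδ0.le hqc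
      (AEStronglyMeasurable.indicator aestronglyMeasurable_const measurableSet_Icc) hbound
    have hfin : a ≤ ENNReal.ofReal C * b + 2⁻¹ * a := by
      refine (hcoer.trans (mul_le_mul_right hgle _)).trans (le_of_eq ?_)
      rw [mul_add, ← mul_assoc, ← ENNReal.ofReal_mul hC0.le]
      congr 2
      rw [show C * (δ * (n + 1)) = 2⁻¹ by rw [hδ]; field_simp,
        ENNReal.ofReal_inv_of_pos two_pos, ENNReal.ofReal_ofNat]
    have hatop : a ≠ ⊤ := hq2.eLpNorm_ne_top
    have hctop : ENNReal.ofReal C * b ≠ ⊤ := ENNReal.mul_ne_top ENNReal.ofReal_ne_top hbtop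
    rw [← ENNReal.toReal_le_toReal hatop (by finiteness)]
    rw [← ENNReal.toReal_le_toReal hatop (by finiteness)] at hfin
    rw [ENNReal.toReal_add hctop (by finiteness), ENNReal.toReal_mul (a := 2⁻¹)] at hfin
    rw [ENNReal.toReal_mul (a := 2)]
    simp only [ENNReal.toReal_inv, ENNReal.toReal_ofNat] at hfin ⊢
    linarith
  have hseq : Tendsto (fun k : ℕ => 1 / ((k : ℝ) + 1)) atTop (𝓝 0) :=
    tendsto_one_div_add_atTop_nhds_zero_nat
  have hlim := Lp.eLpNorm_lim_le_liminf_eLpNorm (p := 2) (μ := (volume : Measure ℝ))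
    (f := fun k : ℕ => weighted R p (1 / ((k : ℝ) + 1)))
    (fun k => ((continuous_weighted (R := R) hp).comp
      (by fun_prop : Continuous fun x : ℝ => (1 / ((k : ℝ) + 1), x))).aestronglyMeasurable)
    (weighted R p 0) (ae_of_all _ fun ξ =>
      (((continuous_weighted (R := R) hp).comp
        (by fun_prop : Continuous fun t : ℝ => (t, ξ))).tendsto 0).comp hseq)
  have hle : eLpNorm (weighted R p 0) 2 volume ≤ 2 * (ENNReal.ofReal C * b) := by
    refine hlim.trans (liminf_le_of_frequently_le' (Eventually.frequently ?_))
    filter_upwards [hseq.eventually hgood] with k hk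
    exact hmain _ (by positivity) hk
  have hmem : MemLp (weighted R p 0) 2 := by
    refine ⟨((continuous_weighted (R := R) hp).comp
      (by fun_prop : Continuous fun x : ℝ => ((0 : ℝ), x))).aestronglyMeasurable,
      hle.trans_lt ?_⟩
    finiteness
  refine ⟨R + 1, (memLp_congr_ae ?_).1 (hmem.restrict (Set.Ici (R + 1)))⟩
  filter_upwards [ae_restrict_mem measurableSet_Ici] with ξ hξ
  rw [weighted_of_ge 0 hξ]
  simp

end Decay

section Line

variable {E : Type*} [NormedAddCommGroup E] [InnerProductSpace ℂ E] [FiniteDimensional ℂ E]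
  {ι : Type*} [Fintype ι]

/-- A bounded solution of a functional differential equation whose coefficients converge at `±∞`
to systems with invertible symbols is square integrable. -/
lemma memLp_two_of_symbol_injective {p : ℝ → E} {B B' c : ℝ} {A : ι → ℝ → E →L[ℂ] E}
    {Ap Am : ι → E →L[ℂ] E} {s : ι → ℝ}
    (hc : c ≠ 0) (hAp : ∀ j, Tendsto (A j) atTop (𝓝 (Ap j)))
    (hAm : ∀ j, Tendsto (A j) atBot (𝓝 (Am j)))
    (hsymp : ∀ ν v, symbol c Ap s ν v = 0 → v = 0)
    (hsymm : ∀ ν v, symbol c Am s ν v = 0 → v = 0)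
    (hp : ContDiff ℝ 1 p) (hB : ∀ ξ, ‖p ξ‖ ≤ B) (hB' : ∀ ξ, ‖deriv p ξ‖ ≤ B')
    (heq : ∀ ξ, c • deriv p ξ = ∑ j, A j ξ (p (ξ + s j))) :
    MemLp p 2 := by
  obtain ⟨R₁, h₁⟩ := exists_memLp_two_Ici hc hAp hsymp hp hB hB' heq
  obtain ⟨R₂, h₂⟩ := exists_memLp_two_Ici (p := fun ξ => p (-ξ)) (c := -c)
    (A := fun j ξ => A j (-ξ)) (A' := Am) (s := fun j => -s j) (B := B) (B' := B')
    (neg_ne_zero.2 hc) (fun j => (hAm j).comp tendsto_neg_atTop_atBot)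
    (fun ν v h => hsymm (-ν) v (by
      rw [← h]; congr 1; simp [symbol]))
    (hp.comp contDiff_neg) (fun ξ => hB _) (fun ξ => by
      rw [deriv_comp_neg, norm_neg]; exact hB' _)
    (fun ξ => by
      rw [deriv_comp_neg, smul_neg, neg_smul, neg_neg, heq]
      refine Finset.sum_congr rfl fun j _ => ?_
      congr 2
      ring)
  have h₃ : MemLp p 2 (volume.restrict (Set.Iic (-R₂))) := by
    have hmp : MeasurePreserving (fun x : ℝ => -x) (volume.restrict (Set.Iic (-R₂)))
        (volume.restrict (Set.Ici R₂)) := by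
      have := (Measure.measurePreserving_neg (volume : Measure ℝ)).restrict_preimage
        (measurableSet_Ici (a := R₂))
      simpa using this
    simpa [Function.comp_def] using h₂.comp_measurePreserving hmp
  have h₄ : MemLp p 2 (volume.restrict (Set.Icc (-R₂) R₁)) :=
    MemLp.of_bound hp.continuous.aestronglyMeasurable B (ae_of_all _ hB)
  rw [← memLp_indicator_iff_restrict (by measurability)] at h₁ h₃ h₄
  refine ((h₁.norm.add h₃.norm).add h₄.norm).mono' hp.continuous.aestronglyMeasurable
    (ae_of_all _ fun x => ?_)
  simp only [Pi.add_apply]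
  have hn : ∀ t : Set ℝ, 0 ≤ ‖t.indicator p x‖ := fun t => norm_nonneg _
  by_cases hx : R₁ ≤ x
  · rw [Set.indicator_of_mem (s := Set.Ici R₁) hx]
    linarith [hn (Set.Iic (-R₂)), hn (Set.Icc (-R₂) R₁)]
  by_cases hx' : x ≤ -R₂
  · rw [Set.indicator_of_mem (s := Set.Iic (-R₂)) hx']
    linarith [hn (Set.Ici R₁), hn (Set.Icc (-R₂) R₁)]
  · rw [Set.indicator_of_mem (s := Set.Icc (-R₂) R₁) ⟨(not_le.1 hx').le, (not_le.1 hx).le⟩]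
    linarith [hn (Set.Iic (-R₂)), hn (Set.Ici R₁)]

end Line

section Linearization

/-- The complexification of a real vector. -/
def complexify (d : ℕ) : Vec d →L[ℝ] EuclideanSpace ℂ (Fin d) :=
  ((EuclideanSpace.equiv (Fin d) ℂ).symm.toContinuousLinearMap.restrictScalars ℝ).comp
    (ContinuousLinearMap.pi fun i => Complex.ofRealCLM.comp (ContinuousLinearMap.proj i))

@[simp] lemma complexify_apply {d : ℕ} (v : Vec d) (i : Fin d) : complexify d v i = (v i : ℂ) :=
  rfl

lemma norm_le_norm_complexify {d : ℕ} (v : Vec d) : ‖v‖ ≤ ‖complexify d v‖ := by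
  refine (pi_norm_le_iff_of_nonneg (norm_nonneg _)).2 fun i => ?_
  have := PiLp.norm_apply_le (complexify d v) i
  simpa using this

/-- The partial derivative `D_j f`, acting on complex vectors. -/
def linCoeff {d : ℕ} (S : Setting d) (j : Fin 5) (a : Fin 5 → Vec d) :
    EuclideanSpace ℂ (Fin d) →L[ℂ] EuclideanSpace ℂ (Fin d) :=
  Matrix.toEuclideanCLM (n := Fin d) (𝕜 := ℂ) (DmatC S j a)

variable {d : ℕ} (S : Setting d)

lemma Setting.contDiff_f : ContDiff ℝ 2 S.f := by
  have : (2 : ℕ∞) ≤ S.r := by exact_mod_cast S.hr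
  exact S.hf.of_le (WithTop.coe_le_coe.2 this)

lemma Setting.contDiff_Φ : ContDiff ℝ 3 S.Φ := by
  have : (2 : ℕ∞) + 1 ≤ S.r + 1 := by
    gcongr
    exact_mod_cast S.hr
  exact S.hΦs.of_le (WithTop.coe_le_coe.2 this)

lemma Setting.continuous_fderiv_f : Continuous (fderiv ℝ S.f) :=
  S.contDiff_f.continuous_fderiv two_ne_zero

lemma linCoeff_complexify (j : Fin 5) (a : Fin 5 → Vec d) (v : Vec d) :
    linCoeff S j a (complexify d v) = complexify d (Dj S j a v) := by
  ext i
  have hv : Dj S j a v = ∑ k, v k • Dj S j a (Pi.single k 1) := by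
    let L : Vec d →ₗ[ℝ] Vec d :=
      (fderiv ℝ S.f a : (Fin 5 → Vec d) →ₗ[ℝ] Vec d) ∘ₗ LinearMap.single ℝ (fun _ => Vec d) j
    have : v = ∑ k, v k • (Pi.single k 1 : Vec d) := pi_eq_sum_univ' v
    conv_lhs => rw [this]
    exact (map_sum L _ _).trans (Finset.sum_congr rfl fun k _ => map_smul L _ _)
  rw [linCoeff, Matrix.ofLp_toEuclideanCLM, complexify_apply, hv]
  simp [Matrix.mulVec, dotProduct, DmatC, mul_comm]

lemma continuous_linCoeff (j : Fin 5) : Continuous (linCoeff S j) := by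
  have h1 : Continuous (DmatC S j) := by
    refine continuous_matrix fun i k => Complex.continuous_ofReal.comp ?_
    exact (continuous_apply i).comp (S.continuous_fderiv_f.clm_apply continuous_const)
  have h2 : Continuous (Matrix.toEuclideanCLM (n := Fin d) (𝕜 := ℂ)) :=
    LinearMap.continuous_of_finiteDimensional
      (Matrix.toEuclideanCLM (n := Fin d) (𝕜 := ℂ)).toAlgEquiv.toLinearMap
  exact h2.comp h1

/-- The shifts occurring in the travelling wave equation. -/
def Setting.shifts (j : Fin 5) : ℝ :=
  ![(S.σA : ℝ), (S.σB : ℝ), -(S.σA : ℝ), -(S.σB : ℝ), 0] j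

lemma tau_eq_shifts (p : Fn d) (ξ : ℝ) (j : Fin 5) :
    tau S.σA S.σB p ξ j = p (ξ + S.shifts j) := by
  fin_cases j <;> simp [tau, Setting.shifts, sub_eq_add_neg]

lemma symbol_linCoeff (u : Vec d) (ν : ℝ) :
    symbol S.cstar (fun j => linCoeff S j fun _ => u) S.shifts ν
      = Matrix.toEuclideanCLM (n := Fin d) (𝕜 := ℂ)
          (charM S u (Complex.I * (0 : ℝ)) (Complex.I * ν)) := by
  have h : ∀ j, linCoeff S j (fun _ => u)
      = Matrix.toEuclideanCLM (n := Fin d) (𝕜 := ℂ) (DmatC S j fun _ => u) := fun j => rfl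
  simp only [symbol, h, charM, map_add, map_smul, map_one, Fin.sum_univ_five, Setting.shifts]
  simp only [ContinuousLinearMap.one_def]
  simp [add_assoc]
  exact (neg_smul _ _).symm

lemma symbol_linCoeff_injective {u : Vec d} {ν : ℝ}
    (hdet : (charM S u (Complex.I * (0 : ℝ)) (Complex.I * ν)).det ≠ 0)
    (v : EuclideanSpace ℂ (Fin d))
    (hv : symbol S.cstar (fun j => linCoeff S j fun _ => u) S.shifts ν v = 0) : v = 0 := by
  rw [symbol_linCoeff] at hv
  have := congrArg WithLp.ofLp hv
  rw [Matrix.ofLp_toEuclideanCLM] at this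
  have h0 := Matrix.eq_zero_of_mulVec_eq_zero hdet this
  exact (WithLp.ofLp_eq_zero 2).1 h0

lemma fderiv_f_eq_sum (a w : Fin 5 → Vec d) :
    fderiv ℝ S.f a w = ∑ j, Dj S j a (w j) := by
  conv_lhs => rw [← Finset.univ_sum_single w, map_sum]
  rfl

lemma hasDerivAt_tau {p : Fn d} (hp : Differentiable ℝ p) (ξ : ℝ) :
    HasDerivAt (tau S.σA S.σB p) (tau S.σA S.σB (deriv p) ξ) ξ := by
  refine hasDerivAt_pi.2 fun j => ?_
  simp only [tau_eq_shifts]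
  exact (hp _).hasDerivAt.comp_add_const ξ (S.shifts j)

lemma norm_tau_le_s5 {p : Fn d} (ξ : ℝ) :
    ‖tau S.σA S.σB p ξ‖ ≤ ∑ j, ‖p (ξ + S.shifts j)‖ := by
  refine (pi_norm_le_iff_of_nonneg (Finset.sum_nonneg fun _ _ => norm_nonneg _)).2 fun j => ?_
  rw [tau_eq_shifts]
  exact Finset.single_le_sum (f := fun j => ‖p (ξ + S.shifts j)‖)
    (fun _ _ => norm_nonneg _) (Finset.mem_univ j)

lemma memLp_sum_norm_shifts {p : Fn d} (hp : MemLp p 2) :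
    MemLp (fun ξ => ∑ j, ‖p (ξ + S.shifts j)‖) 2 :=
  memLp_finsetSum _ fun j _ =>
    (hp.comp_measurePreserving (measurePreserving_add_right volume (S.shifts j))).norm

lemma tendsto_tauPt {l l' : Filter ℝ} {u : Vec d} (h : Tendsto S.Φ l' (𝓝 u))
    (hl : ∀ t : ℝ, Tendsto (fun ξ => ξ + t) l l') :
    Tendsto (tauPt S) l (𝓝 fun _ => u) := by
  refine tendsto_pi_nhds.2 fun j => ?_
  simp only [tauPt, tau_eq_shifts]
  exact h.comp (hl _)

lemma exists_norm_Φ_le : ∃ B, ∀ ξ, ‖S.Φ ξ‖ ≤ B := by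
  have hp := (S.hΦp.norm.eventually (eventually_le_nhds (lt_add_one ‖S.up‖)))
  have hm := (S.hΦm.norm.eventually (eventually_le_nhds (lt_add_one ‖S.um‖)))
  obtain ⟨b, hb⟩ := eventually_atTop.1 hp
  obtain ⟨a, ha⟩ := eventually_atBot.1 hm
  obtain ⟨C, hC⟩ := (isCompact_Icc (a := a) (b := b)).exists_bound_of_continuousOn
    S.contDiff_Φ.continuous.continuousOn
  refine ⟨max C (max (‖S.up‖ + 1) (‖S.um‖ + 1)), fun ξ => ?_⟩
  rcases le_total b ξ with h | h
  · exact (hb ξ h).trans (by simp)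
  rcases le_total ξ a with h' | h'
  · exact (ha ξ h').trans (by simp)
  · exact (hC ξ ⟨h', h⟩).trans (by simp)

lemma exists_norm_comp_tauPt_le {F : Type*} [NormedAddCommGroup F] {G : (Fin 5 → Vec d) → F}
    (hG : Continuous G) : ∃ C, 0 ≤ C ∧ ∀ ξ, ‖G (tauPt S ξ)‖ ≤ C := by
  obtain ⟨B, hB⟩ := exists_norm_Φ_le S
  have hB0 : 0 ≤ B := (norm_nonneg _).trans (hB 0)
  obtain ⟨C, hC⟩ := (isCompact_closedBall (0 : Fin 5 → Vec d) B).exists_bound_of_continuousOn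
    hG.continuousOn
  have hC' : ∀ ξ, ‖G (tauPt S ξ)‖ ≤ C := fun ξ => hC _ <| by
    rw [mem_closedBall_zero_iff]
    refine (pi_norm_le_iff_of_nonneg hB0).2 fun j => ?_
    rw [tauPt, tau_eq_shifts]
    exact hB _
  exact ⟨C, (norm_nonneg _).trans (hC' 0), hC'⟩

lemma hasDerivAt_tauPt (ξ : ℝ) :
    HasDerivAt (tauPt S) (tau S.σA S.σB (deriv S.Φ) ξ) ξ :=
  hasDerivAt_tau S (S.contDiff_Φ.differentiable (by norm_num)) ξ

lemma Setting.contDiff_deriv_Φ : ContDiff ℝ 2 (deriv S.Φ) := by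
  have h : ContDiff ℝ (2 + 1) S.Φ := S.contDiff_Φ
  exact (contDiff_succ_iff_deriv.1 h).2.2

lemma Setting.contDiff_deriv_deriv_Φ : ContDiff ℝ 1 (deriv (deriv S.Φ)) := by
  have h : ContDiff ℝ (1 + 1) (deriv S.Φ) := S.contDiff_deriv_Φ
  exact (contDiff_succ_iff_deriv.1 h).2.2

lemma smul_deriv_deriv_Φ (ξ : ℝ) :
    S.cstar • deriv (deriv S.Φ) ξ
      = fderiv ℝ S.f (tauPt S ξ) (tau S.σA S.σB (deriv S.Φ) ξ) := by
  have h1 : HasDerivAt (fun ξ => S.cstar • deriv S.Φ ξ) (S.cstar • deriv (deriv S.Φ) ξ) ξ :=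
    ((S.contDiff_deriv_Φ.differentiable two_ne_zero) ξ).hasDerivAt.fun_const_smul _
  have h2 : HasDerivAt (fun ξ => S.f (tauPt S ξ))
      (fderiv ℝ S.f (tauPt S ξ) (tau S.σA S.σB (deriv S.Φ) ξ)) ξ :=
    ((S.contDiff_f.differentiable two_ne_zero) _).hasFDerivAt.comp_hasDerivAt ξ
      (hasDerivAt_tauPt S ξ)
  have h3 : (fun ξ => S.cstar • deriv S.Φ ξ) = fun ξ => S.f (tauPt S ξ) := funext S.hMFDE
  rw [h3] at h1
  exact h1.unique h2

lemma smul_deriv_deriv_deriv_Φ (ξ : ℝ) :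
    S.cstar • deriv (deriv (deriv S.Φ)) ξ
      = fderiv ℝ (fderiv ℝ S.f) (tauPt S ξ) (tau S.σA S.σB (deriv S.Φ) ξ)
          (tau S.σA S.σB (deriv S.Φ) ξ)
        + fderiv ℝ S.f (tauPt S ξ) (tau S.σA S.σB (deriv (deriv S.Φ)) ξ) := by
  have h1 : HasDerivAt (fun ξ => S.cstar • deriv (deriv S.Φ) ξ)
      (S.cstar • deriv (deriv (deriv S.Φ)) ξ) ξ :=
    ((S.contDiff_deriv_deriv_Φ.differentiable one_ne_zero) ξ).hasDerivAt.fun_const_smul _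
  have hf : ContDiff ℝ 1 (fderiv ℝ S.f) := S.contDiff_f.fderiv_right (by norm_num)
  have h2 : HasDerivAt (fun ξ => fderiv ℝ S.f (tauPt S ξ))
      (fderiv ℝ (fderiv ℝ S.f) (tauPt S ξ) (tau S.σA S.σB (deriv S.Φ) ξ)) ξ :=
    ((hf.differentiable one_ne_zero) _).hasFDerivAt.comp_hasDerivAt ξ (hasDerivAt_tauPt S ξ)
  have h3 := h2.clm_apply (hasDerivAt_tau S (S.contDiff_deriv_Φ.differentiable two_ne_zero) ξ)
  rw [funext (smul_deriv_deriv_Φ S)] at h1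
  exact h1.unique h3

lemma norm_le_of_smul_le {v : Vec d} {b : ℝ} (h : ‖S.cstar • v‖ ≤ b) : ‖v‖ ≤ |S.cstar|⁻¹ * b := by
  rw [norm_smul, Real.norm_eq_abs] at h
  rwa [le_inv_mul_iff₀ (abs_pos.2 S.hcne)]

lemma exists_norm_deriv_Φ_le : ∃ B, ∀ ξ, ‖deriv S.Φ ξ‖ ≤ B := by
  obtain ⟨C, -, hC⟩ := exists_norm_comp_tauPt_le S S.contDiff_f.continuous
  exact ⟨_, fun ξ => norm_le_of_smul_le S (by rw [S.hMFDE ξ]; exact hC ξ)⟩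

lemma exists_norm_deriv_deriv_Φ_le :
    ∃ C, ∀ ξ, ‖deriv (deriv S.Φ) ξ‖ ≤ C * ∑ j, ‖deriv S.Φ (ξ + S.shifts j)‖ := by
  obtain ⟨C, hC0, hC⟩ := exists_norm_comp_tauPt_le S S.continuous_fderiv_f
  refine ⟨|S.cstar|⁻¹ * C, fun ξ => ?_⟩
  rw [mul_assoc]
  refine norm_le_of_smul_le S ?_
  rw [smul_deriv_deriv_Φ]
  exact ((fderiv ℝ S.f (tauPt S ξ)).le_opNorm _).trans
    (mul_le_mul (hC ξ) (norm_tau_le_s5 S ξ) (norm_nonneg _) hC0)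

/-- The derivative of the wave profile is square integrable. -/
lemma memLp_deriv_Φ (hS1 : HS1 S) : MemLp (deriv S.Φ) 2 := by
  have h0 : (0 : ℝ) ∈ Set.Icc (-Real.pi) Real.pi := ⟨by linarith [Real.pi_pos], Real.pi_pos.le⟩
  obtain ⟨B, hB⟩ := exists_norm_deriv_Φ_le S
  obtain ⟨C, hC⟩ := exists_norm_deriv_deriv_Φ_le S
  have hC' : ∀ ξ, ‖deriv (deriv S.Φ) ξ‖ ≤ |C| * (5 * B) := fun ξ => by
    refine (hC ξ).trans (mul_le_mul (le_abs_self _) ?_ (by positivity) (abs_nonneg _))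
    refine (Finset.sum_le_sum fun j _ => hB (ξ + S.shifts j)).trans ?_
    simp
  have hder : ∀ ξ, deriv (fun ξ => complexify d (deriv S.Φ ξ)) ξ
      = complexify d (deriv (deriv S.Φ) ξ) := fun ξ =>
    ((complexify d).hasFDerivAt.comp_hasDerivAt ξ
      ((S.contDiff_deriv_Φ.differentiable two_ne_zero) ξ).hasDerivAt).deriv
  have hmem : MemLp (fun ξ => complexify d (deriv S.Φ ξ)) 2 := by
    refine memLp_two_of_symbol_injective (c := S.cstar) (s := S.shifts)
      (A := fun j ξ => linCoeff S j (tauPt S ξ)) S.hcne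
      (fun j => ((continuous_linCoeff S j).tendsto _).comp
        (tendsto_tauPt S S.hΦp fun t => tendsto_atTop_add_const_right _ t tendsto_id))
      (fun j => ((continuous_linCoeff S j).tendsto _).comp
        (tendsto_tauPt S S.hΦm fun t => tendsto_atBot_add_const_right _ t tendsto_id))
      (fun ν => symbol_linCoeff_injective S (hS1 0 h0 ν).1)
      (fun ν => symbol_linCoeff_injective S (hS1 0 h0 ν).2)
      ((complexify d).contDiff.comp (S.contDiff_deriv_Φ.of_le one_le_two))
      (B := ‖complexify d‖ * B) (B' := ‖complexify d‖ * (|C| * (5 * B))) (fun ξ => ?_)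
      (fun ξ => ?_) fun ξ => ?_
    · exact (complexify d).le_opNorm_of_le (hB ξ)
    · rw [hder]
      exact (complexify d).le_opNorm_of_le (hC' ξ)
    · rw [hder, ← map_smul, smul_deriv_deriv_Φ, fderiv_f_eq_sum, map_sum]
      simp only [linCoeff_complexify, tau_eq_shifts]
  exact hmem.mono S.contDiff_deriv_Φ.continuous.aestronglyMeasurable
    (ae_of_all _ fun ξ => norm_le_norm_complexify _)

lemma memLp_deriv_deriv_Φ (hS1 : HS1 S) : MemLp (deriv (deriv S.Φ)) 2 := by
  obtain ⟨C, hC⟩ := exists_norm_deriv_deriv_Φ_le S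
  exact ((memLp_sum_norm_shifts S (memLp_deriv_Φ S hS1)).const_mul C).mono'
    S.contDiff_deriv_deriv_Φ.continuous.aestronglyMeasurable (ae_of_all _ hC)

lemma memLp_deriv_deriv_deriv_Φ (hS1 : HS1 S) : MemLp (deriv (deriv (deriv S.Φ))) 2 := by
  obtain ⟨B, hB⟩ := exists_norm_deriv_Φ_le S
  have hB0 : 0 ≤ B := (norm_nonneg _).trans (hB 0)
  obtain ⟨C₁, hC₁0, hC₁⟩ := exists_norm_comp_tauPt_le S S.continuous_fderiv_f
  have hf : ContDiff ℝ 1 (fderiv ℝ S.f) := S.contDiff_f.fderiv_right (by norm_num)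
  obtain ⟨C₂, hC₂0, hC₂⟩ := exists_norm_comp_tauPt_le S (hf.continuous_fderiv one_ne_zero)
  refine ((((memLp_sum_norm_shifts S (memLp_deriv_Φ S hS1)).const_mul (C₂ * B)).add
    ((memLp_sum_norm_shifts S (memLp_deriv_deriv_Φ S hS1)).const_mul C₁)).const_mul
      |S.cstar|⁻¹).mono' (S.contDiff_deriv_deriv_Φ.continuous_deriv
        le_rfl).aestronglyMeasurable (ae_of_all _ fun ξ => norm_le_of_smul_le S ?_)
  rw [smul_deriv_deriv_deriv_Φ]
  refine (norm_add_le _ _).trans (add_le_add ?_ ?_)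
  · have hT : ‖tau S.σA S.σB (deriv S.Φ) ξ‖ ≤ B :=
      (pi_norm_le_iff_of_nonneg hB0).2 fun j => by rw [tau_eq_shifts]; exact hB _
    refine ((fderiv ℝ (fderiv ℝ S.f) (tauPt S ξ)).le_opNorm₂ _ _).trans ?_
    exact mul_le_mul (mul_le_mul (hC₂ ξ) hT (norm_nonneg _) hC₂0) (norm_tau_le_s5 S ξ)
      (norm_nonneg _) (by positivity)
  · exact ((fderiv ℝ S.f (tauPt S ξ)).le_opNorm _).trans
      (mul_le_mul (hC₁ ξ) (norm_tau_le_s5 S ξ) (norm_nonneg _) hC₁0)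

end Linearization

section TaylorRemainder

variable {V : Type*} [NormedAddCommGroup V] [NormedSpace ℝ V]

lemma eLpNorm_two_intervalIntegral_le {F : ℝ → ℝ → V} (hF : Continuous (Function.uncurry F))
    {a b K : ℝ}
    (hK : ∀ s ∈ Set.uIoc a b, eLpNorm (fun x => F x s) 2 volume ≤ ENNReal.ofReal K) :
    eLpNorm (fun x => ∫ s in a..b, F x s) 2 volume ≤ ENNReal.ofReal (|b - a| * K) := by
  set ν := (volume : Measure ℝ).restrict (Set.uIoc a b) with hν
  have hνuniv : ν Set.univ = ENNReal.ofReal |b - a| := by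
    simp [hν, Set.uIoc, Real.volume_Ioc, max_sub_min_eq_abs]
  have hsq : ∀ {α : Type} [MeasurableSpace α] (μ : Measure α) (g : α → V),
      eLpNorm g 2 μ ^ (2 : ℝ) = ∫⁻ x, ‖g x‖ₑ ^ (2 : ℝ) ∂μ := fun μ g => by
    rw [eLpNorm_eq_lintegral_rpow_enorm_toReal two_ne_zero ENNReal.ofNat_ne_top,
      ← ENNReal.rpow_mul]
    norm_num
  have hpt : ∀ x, ‖∫ s in a..b, F x s‖ₑ ^ (2 : ℝ)
      ≤ ENNReal.ofReal |b - a| * ∫⁻ s, ‖F x s‖ₑ ^ (2 : ℝ) ∂ν := fun x => by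
    have hFx : Continuous (F x) := hF.comp (by fun_prop : Continuous fun s : ℝ => (x, s))
    have h1 : ‖∫ s in a..b, F x s‖ₑ ≤ eLpNorm (F x) 1 ν := by
      rw [eLpNorm_one_eq_lintegral_enorm, ← ofReal_norm,
        intervalIntegral.norm_intervalIntegral_eq, ofReal_norm]
      exact enorm_integral_le_lintegral_enorm _
    have h2 := h1.trans (eLpNorm_le_eLpNorm_mul_rpow_measure_univ one_le_two
      (hFx.aestronglyMeasurable (μ := ν)))
    rw [← hsq, ← hνuniv]
    refine (ENNReal.rpow_le_rpow h2 zero_le_two).trans (le_of_eq ?_)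
    rw [ENNReal.mul_rpow_of_nonneg _ _ zero_le_two, ← ENNReal.rpow_mul, mul_comm]
    norm_num
  have hmeas : Measurable fun z : ℝ × ℝ => ‖F z.1 z.2‖ₑ ^ (2 : ℝ) :=
    ((hF.enorm).measurable).pow_const _
  have hfin : eLpNorm (fun x => ∫ s in a..b, F x s) 2 volume ^ (2 : ℝ)
      ≤ ENNReal.ofReal (|b - a| * K) ^ (2 : ℝ) := by
    rw [hsq]
    calc ∫⁻ x, ‖∫ s in a..b, F x s‖ₑ ^ (2 : ℝ)
        ≤ ∫⁻ x, ENNReal.ofReal |b - a| * ∫⁻ s, ‖F x s‖ₑ ^ (2 : ℝ) ∂ν := lintegral_mono hpt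
      _ = ENNReal.ofReal |b - a| * ∫⁻ s, (∫⁻ x, ‖F x s‖ₑ ^ (2 : ℝ)) ∂ν := by
          rw [lintegral_const_mul' _ _ ENNReal.ofReal_ne_top,
            lintegral_lintegral_swap hmeas.aemeasurable]
      _ ≤ ENNReal.ofReal |b - a| * ∫⁻ s, ENNReal.ofReal K ^ (2 : ℝ) ∂ν := by
          refine mul_le_mul_right (lintegral_mono_ae ?_) _
          filter_upwards [ae_restrict_mem measurableSet_uIoc] with s hs
          rw [← hsq]
          exact ENNReal.rpow_le_rpow (hK s hs) zero_le_two
      _ = ENNReal.ofReal (|b - a| * K) ^ (2 : ℝ) := by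
          rw [lintegral_const, hνuniv, ENNReal.ofReal_mul (abs_nonneg _),
            ENNReal.mul_rpow_of_nonneg _ _ zero_le_two, mul_comm (ENNReal.ofReal K ^ _),
            ← mul_assoc]
          congr 1
          rw [ENNReal.rpow_two, sq]
  exact (ENNReal.rpow_le_rpow_iff two_pos).1 hfin

variable [CompleteSpace V] {G : ℝ → V} {M : ℝ}

lemma eLpNorm_two_shift_sub_shift_le (hG : ContDiff ℝ 1 G)
    (hM : eLpNorm (deriv G) 2 volume ≤ ENNReal.ofReal M) (a b : ℝ) :
    eLpNorm (fun x => G (x + a) - G (x + b)) 2 volume ≤ ENNReal.ofReal (|a - b| * M) := by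
  have hc := hG.continuous_deriv le_rfl
  have h : (fun x => G (x + a) - G (x + b)) = fun x => ∫ s in b..a, deriv G (x + s) := by
    ext x
    refine (intervalIntegral.integral_eq_sub_of_hasDerivAt (f := fun s => G (x + s))
      (fun s _ => ?_) (Continuous.intervalIntegrable (by fun_prop) _ _)).symm
    exact ((hG.differentiable one_ne_zero) _).hasDerivAt.comp_const_add x s
  rw [h]
  refine eLpNorm_two_intervalIntegral_le (by fun_prop) fun s _ => ?_
  rwa [← eLpNorm_comp_measurePreserving hc.aestronglyMeasurable
    (measurePreserving_add_right volume s)] at hM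

/-- The remainder of the first order Taylor expansion of `G`. -/
def taylorRem (G : ℝ → V) (ϑ θ x : ℝ) : V := G (x + ϑ + θ) - G (x + ϑ) - θ • deriv G (x + ϑ)

omit [CompleteSpace V] in
lemma hasDerivAt_taylorRem (hG : Differentiable ℝ G) (ϑ θ x : ℝ) :
    HasDerivAt (fun θ => taylorRem G ϑ θ x) (deriv G (x + ϑ + θ) - deriv G (x + ϑ)) θ := by
  have h1 := ((hG (x + ϑ + θ)).hasDerivAt.comp_const_add (x + ϑ) θ).sub_const (G (x + ϑ))
  have h2 := (hasDerivAt_id θ).smul_const (deriv G (x + ϑ))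
  rw [one_smul] at h2
  exact h1.fun_sub h2

omit [CompleteSpace V] in
lemma continuous_taylorRem (hG : ContDiff ℝ 1 G) (ϑ θ : ℝ) : Continuous (taylorRem G ϑ θ) := by
  have h1 := hG.continuous
  have h2 := hG.continuous_deriv le_rfl
  unfold taylorRem
  fun_prop

lemma eLpNorm_two_taylorRem_sub_le (hG : ContDiff ℝ 2 G) (hM0 : 0 ≤ M)
    (hM : eLpNorm (deriv (deriv G)) 2 volume ≤ ENNReal.ofReal M) (ϑA ϑB θA θB : ℝ) :
    eLpNorm (fun x => taylorRem G ϑA θA x - taylorRem G ϑB θB x) 2 volume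
      ≤ ENNReal.ofReal (2 * M * (|ϑA - ϑB| + |θA| + |θB|) * (|ϑA - ϑB| + |θA - θB|)) := by
  have hG1 : ContDiff ℝ 1 G := hG.of_le one_le_two
  have hd : Differentiable ℝ G := hG.differentiable two_ne_zero
  have hG' : ContDiff ℝ 1 (deriv G) := by
    have h : ContDiff ℝ (1 + 1) G := hG
    exact (contDiff_succ_iff_deriv.1 h).2.2
  have hc := hG'.continuous
  have h1 : eLpNorm (fun x => taylorRem G ϑA θA x - taylorRem G ϑA θB x) 2 volume
      ≤ ENNReal.ofReal (|θA - θB| * ((|θA| + |θB|) * M)) := by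
    have h : (fun x => taylorRem G ϑA θA x - taylorRem G ϑA θB x)
        = fun x => ∫ s in θB..θA, (deriv G (x + ϑA + s) - deriv G (x + ϑA)) := by
      ext x
      exact (intervalIntegral.integral_eq_sub_of_hasDerivAt
        (fun s _ => hasDerivAt_taylorRem hd ϑA s x)
        (Continuous.intervalIntegrable (by fun_prop) _ _)).symm
    rw [h]
    refine eLpNorm_two_intervalIntegral_le (by fun_prop) fun s hs => ?_
    have h2 := eLpNorm_two_shift_sub_shift_le hG' hM (ϑA + s) ϑA
    simp only [← add_assoc] at h2
    refine h2.trans (ENNReal.ofReal_le_ofReal (mul_le_mul_of_nonneg_right ?_ hM0))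
    rw [add_sub_cancel_left]
    rcases Set.mem_uIoc.1 hs with hs | hs
    · exact (abs_le_max_abs_abs hs.1.le hs.2).trans
        (max_le (by linarith [abs_nonneg θA]) (by linarith [abs_nonneg θB]))
    · exact (abs_le_max_abs_abs hs.1.le hs.2).trans
        (max_le (by linarith [abs_nonneg θB]) (by linarith [abs_nonneg θA]))
  have h2 : eLpNorm (fun x => taylorRem G ϑA θB x - taylorRem G ϑB θB x) 2 volume
      ≤ ENNReal.ofReal (|θB - 0| * (|ϑA - ϑB| * M + |ϑA - ϑB| * M)) := by
    have h : (fun x => taylorRem G ϑA θB x - taylorRem G ϑB θB x)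
        = fun x => ∫ s in 0..θB, ((deriv G (x + (ϑA + s)) - deriv G (x + (ϑB + s)))
            - (deriv G (x + ϑA) - deriv G (x + ϑB))) := by
      ext x
      have := intervalIntegral.integral_eq_sub_of_hasDerivAt (a := 0) (b := θB)
        (fun s _ => (hasDerivAt_taylorRem hd ϑA s x).fun_sub (hasDerivAt_taylorRem hd ϑB s x))
        (Continuous.intervalIntegrable (by fun_prop) _ _)
      have h0 : ∀ ϑ, taylorRem G ϑ 0 x = 0 := fun ϑ => by simp [taylorRem]
      rw [h0, h0, sub_zero, sub_zero] at this
      rw [← this]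
      refine intervalIntegral.integral_congr fun s _ => ?_
      simp only [add_assoc]
      abel
    rw [h]
    refine eLpNorm_two_intervalIntegral_le (by fun_prop) fun s hs => ?_
    refine (eLpNorm_sub_le (f := fun x => deriv G (x + (ϑA + s)) - deriv G (x + (ϑB + s)))
      (g := fun x => deriv G (x + ϑA) - deriv G (x + ϑB))
      (Continuous.aestronglyMeasurable (by fun_prop))
      (Continuous.aestronglyMeasurable (by fun_prop)) one_le_two).trans ?_
    rw [ENNReal.ofReal_add (by positivity) (by positivity)]
    refine add_le_add ?_ (eLpNorm_two_shift_sub_shift_le hG' hM ϑA ϑB)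
    simpa using eLpNorm_two_shift_sub_shift_le hG' hM (ϑA + s) (ϑB + s)
  have hsum : (fun x => taylorRem G ϑA θA x - taylorRem G ϑB θB x)
      = (fun x => taylorRem G ϑA θA x - taylorRem G ϑA θB x)
        + fun x => taylorRem G ϑA θB x - taylorRem G ϑB θB x := by
    ext x
    simp
  have hm := continuous_taylorRem hG1
  rw [hsum]
  refine (eLpNorm_add_le (Continuous.aestronglyMeasurable (by fun_prop))
    (Continuous.aestronglyMeasurable (by fun_prop)) one_le_two).trans ((add_le_add h1 h2).trans ?_)
  rw [← ENNReal.ofReal_add (by positivity) (by positivity), sub_zero]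
  refine ENNReal.ofReal_le_ofReal ?_
  have e1 := abs_nonneg (ϑA - ϑB)
  have e2 := abs_nonneg (θA - θB)
  have e3 := abs_nonneg θA
  have e4 := abs_nonneg θB
  have : 0 ≤ M * (|ϑA - ϑB| * |ϑA - ϑB| + |ϑA - ϑB| * |θA - θB| + |θA| * |ϑA - ϑB|)
      + M * (|ϑA - ϑB| * |ϑA - ϑB| + |ϑA - ϑB| * |θA - θB| + |θA| * |ϑA - ϑB|)
      + M * (|θA - θB| * (|θA| + |θB|)) := by positivity
  linarith

omit [CompleteSpace V] in
lemma hasDerivAt_taylorRem_right (hG : ContDiff ℝ 2 G) (ϑ θ x : ℝ) :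
    HasDerivAt (taylorRem G ϑ θ) (taylorRem (deriv G) ϑ θ x) x := by
  have hd : Differentiable ℝ G := hG.differentiable two_ne_zero
  have hd' : Differentiable ℝ (deriv G) := by
    have h : ContDiff ℝ (1 + 1) G := hG
    exact (contDiff_succ_iff_deriv.1 h).2.2.differentiable one_ne_zero
  have h1 : HasDerivAt (fun x => G (x + ϑ + θ)) (deriv G (x + ϑ + θ)) x := by
    simpa only [add_assoc] using (hd (x + (ϑ + θ))).hasDerivAt.comp_add_const x (ϑ + θ)
  have h2 := (hd (x + ϑ)).hasDerivAt.comp_add_const x ϑ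
  have h3 := ((hd' (x + ϑ)).hasDerivAt.comp_add_const x ϑ).fun_const_smul θ
  exact (h1.fun_sub h2).fun_sub h3

end TaylorRemainder

lemma L2norm_le_of_eLpNorm_le {d : ℕ} {g : Fn d} (hg : AEStronglyMeasurable g) {K : ℝ}
    (hK0 : 0 ≤ K) (hK : eLpNorm g 2 volume ≤ ENNReal.ofReal K) : L2norm g ≤ K := by
  have hmem : MemLp g 2 := ⟨hg, hK.trans_lt ENNReal.ofReal_lt_top⟩
  rw [hmem.eLpNorm_eq_integral_rpow_norm two_ne_zero ENNReal.ofNat_ne_top,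
    ENNReal.ofReal_le_ofReal_iff hK0] at hK
  rw [L2norm, Real.sqrt_eq_rpow]
  simpa using hK

/-- Lemma 3.3: quadratic and Lipschitz bounds for the
nonlinearity `N_{Φ_*;ϑ}`. -/
theorem NPhi_bounds {d : ℕ} (S : Setting d) (hS1 : HS1 S) :
    ∃ K > (0 : ℝ),
      (∀ ϑ θd : ℝ, H1norm (NPhi S ϑ θd) ≤ K * |θd| ^ 2) ∧
      (∀ ϑA ϑB θdA θdB : ℝ,
        H1norm (fun ξ => NPhi S ϑA θdA ξ - NPhi S ϑB θdB ξ) ≤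
          K * (|ϑA - ϑB| + |θdA| + |θdB|) * (|ϑA - ϑB| + |θdA - θdB|)) := by
  obtain ⟨M₂, hM₂0, hM₂⟩ : ∃ M : ℝ, 0 ≤ M ∧
      eLpNorm (deriv (deriv S.Φ)) 2 volume ≤ ENNReal.ofReal M :=
    ⟨_, ENNReal.toReal_nonneg,
      (ENNReal.ofReal_toReal (memLp_deriv_deriv_Φ S hS1).eLpNorm_ne_top).ge⟩
  obtain ⟨M₃, hM₃0, hM₃⟩ : ∃ M : ℝ, 0 ≤ M ∧
      eLpNorm (deriv (deriv (deriv S.Φ))) 2 volume ≤ ENNReal.ofReal M :=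
    ⟨_, ENNReal.toReal_nonneg,
      (ENNReal.ofReal_toReal (memLp_deriv_deriv_deriv_Φ S hS1).eLpNorm_ne_top).ge⟩
  have hΦ : ContDiff ℝ 2 S.Φ := S.contDiff_Φ.of_le (by norm_num)
  have hΦ' := S.contDiff_deriv_Φ
  have hlip : ∀ ϑA ϑB θdA θdB : ℝ,
      H1norm (fun ξ => NPhi S ϑA θdA ξ - NPhi S ϑB θdB ξ) ≤
        (2 * M₂ + 2 * M₃ + 1) * (|ϑA - ϑB| + |θdA| + |θdB|) * (|ϑA - ϑB| + |θdA - θdB|) := by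
    intro ϑA ϑB θA θB
    have hder : deriv (fun ξ => NPhi S ϑA θA ξ - NPhi S ϑB θB ξ)
        = fun ξ => taylorRem (deriv S.Φ) ϑA θA ξ - taylorRem (deriv S.Φ) ϑB θB ξ :=
      funext fun ξ => ((hasDerivAt_taylorRem_right hΦ ϑA θA ξ).fun_sub
        (hasDerivAt_taylorRem_right hΦ ϑB θB ξ)).deriv
    have h1 : L2norm (fun ξ => NPhi S ϑA θA ξ - NPhi S ϑB θB ξ) ≤ _ :=
      L2norm_le_of_eLpNorm_le
        ((continuous_taylorRem (hΦ.of_le one_le_two) ϑA θA).sub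
          (continuous_taylorRem (hΦ.of_le one_le_two) ϑB θB)).aestronglyMeasurable
        (by positivity) (eLpNorm_two_taylorRem_sub_le hΦ hM₂0 hM₂ ϑA ϑB θA θB)
    have h2 := L2norm_le_of_eLpNorm_le
        ((continuous_taylorRem (hΦ'.of_le one_le_two) ϑA θA).sub
          (continuous_taylorRem (hΦ'.of_le one_le_two) ϑB θB)).aestronglyMeasurable
        (by positivity) (eLpNorm_two_taylorRem_sub_le hΦ' hM₃0 hM₃ ϑA ϑB θA θB)
    rw [H1norm, hder]
    have h3 : 0 ≤ (|ϑA - ϑB| + |θA| + |θB|) * (|ϑA - ϑB| + |θA - θB|) := by positivity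
    refine (add_le_add h1 h2).trans ?_
    linarith
  refine ⟨2 * M₂ + 2 * M₃ + 1, by positivity, fun ϑ θd => ?_, hlip⟩
  have h := hlip ϑ ϑ θd 0
  have h0 : ∀ ξ, NPhi S ϑ 0 ξ = 0 := fun ξ => by simp [NPhi]
  simp only [h0, sub_zero, sub_self, abs_zero, zero_add, add_zero] at h
  rwa [sq, ← mul_assoc]

end TravellingCorners
end
end
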